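/- arXiv:1810.01737 — 4 statements merged into one kernel-verified Lean document; each statement's English description precedes it below -/
import Mathlib

section
/- Let p be a prime, let k be an algebraic closure of the field with p elements, let d ≥ 1, and let S be a finite subset of GL_d(k) such that the only k-subspaces of k^d invariant under every element of S are 0 and k^d. Let E be the subfield of k generated by the set of traces of all products of at most 2d² elements of S. Then E is a finite field, and there exists g ∈ GL_d(k) such that conjugation by g carries the F_p-subalgebra of M_d(k) generated by S onto the set of all matrices in M_d(k) whose entries all lie in E (a copy of M_d(E)). In particular, g⁻¹ T g has all its entries in E for every T in the subgroup of GL_d(k) generated by S, so this subgroup is conjugate to a subgroup of GL_d(E). -/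
open Module

/-- A nontrivial module over a finite ring has a finite simple submodule. -/
theorem exists_isSimpleModule_finite {R M : Type*} [Ring R] [Finite R] [AddCommGroup M]
    [Module R M] [Nontrivial M] : ∃ U : Submodule R M, IsSimpleModule R U ∧ Finite U := by
  obtain ⟨v, hv⟩ := exists_ne (0 : M)
  have hfin : Finite (Submodule.span R {v}) :=
    Set.Finite.to_subtype (by
      rw [← LinearMap.range_toSpanSingleton]
      exact Set.finite_range (LinearMap.toSpanSingleton R M v))
  have : Nontrivial (Submodule.span R {v}) :=
    (Submodule.nontrivial_iff_ne_bot).2 (by simpa using hv)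
  obtain ⟨a, ha⟩ := IsAtomic.exists_atom (Submodule R (Submodule.span R {v}))
  have hs : IsSimpleModule R a := isSimpleModule_iff_isAtom.2 ha
  have e := Submodule.equivSubtypeMap _ a
  exact ⟨_, IsSimpleModule.congr e.symm, Finite.of_equiv _ e.toEquiv⟩

section
variable {k V : Type*} [Field k] [AddCommGroup V] [Module k V]

/-- The scalars of `k` whose homotheties lie in a finite ring `R` of endomorphisms. -/
def scalarSubfield (R : Subring (End k V)) [Finite R] [Nontrivial V] : Subfield k :=
  { R.comap (algebraMap k (End k V)) with
    inv_mem' := by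
      intro c hc
      change algebraMap k (End k V) c ∈ R at hc
      change algebraMap k (End k V) c⁻¹ ∈ R
      rcases eq_or_ne c 0 with rfl | h0
      · simp
      have hinj : Function.Injective (fun x : R => (⟨_, hc⟩ : R) * x) := by
        intro x y hxy
        have h1 : algebraMap k (End k V) c * x = algebraMap k (End k V) c * y :=
          congrArg Subtype.val hxy
        have h2 : algebraMap k (End k V) c⁻¹ * algebraMap k (End k V) c = 1 := by
          rw [← map_mul, inv_mul_cancel₀ h0, map_one]
        apply Subtype.ext
        rw [← one_mul (x : End k V), ← h2, mul_assoc, h1, ← mul_assoc, h2, one_mul]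
      obtain ⟨x, hx⟩ := Finite.surjective_of_injective hinj 1
      have h1 : algebraMap k (End k V) c * x = 1 := congrArg Subtype.val hx
      have h2 : algebraMap k (End k V) c⁻¹ * algebraMap k (End k V) c = 1 := by
        rw [← map_mul, inv_mul_cancel₀ h0, map_one]
      have : algebraMap k (End k V) c⁻¹ = x := by
        rw [← mul_one (algebraMap k (End k V) c⁻¹), ← h1, ← mul_assoc, h2, one_mul]
      rw [this]
      exact x.2 }

theorem mem_scalarSubfield (R : Subring (End k V)) [Finite R] [Nontrivial V] {c : k} :
    c ∈ scalarSubfield R ↔ algebraMap k (End k V) c ∈ R := Iff.rfl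

/-- A finite irreducible ring of endomorphisms over an algebraically closed field consists of the
endomorphisms whose matrix in a suitable basis has entries in its field of scalars. -/
theorem exists_basis_mem_iff [IsAlgClosed k] [FiniteDimensional k V] [Nontrivial V]
    (R : Subring (End k V)) [Finite R]
    (hirr : ∀ W : Submodule k V, (∀ f ∈ R, ∀ x ∈ W, f x ∈ W) → W = ⊥ ∨ W = ⊤) :
    ∃ b : Basis (Fin (finrank k V)) k V, ∀ f : End k V,
      f ∈ R ↔ ∀ i j, b.repr (f (b j)) i ∈ scalarSubfield R := by
  classical
  obtain ⟨U, hU, hUfin⟩ := exists_isSimpleModule_finite (R := R) (M := V)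
  have hspan : Submodule.span k (U : Set V) = ⊤ := by
    refine (hirr _ ?_).resolve_left ?_
    · intro f hf x hx
      induction hx using Submodule.span_induction with
      | mem x hx => exact Submodule.subset_span (U.smul_mem ⟨f, hf⟩ hx)
      | zero => simp
      | add x y _ _ hx hy => rw [map_add]; exact add_mem hx hy
      | smul c x _ hx => rw [map_smul]; exact Submodule.smul_mem _ _ hx
    · have := IsSimpleModule.nontrivial R U
      obtain ⟨u, hu⟩ := exists_ne (0 : U)
      intro h
      rw [Submodule.span_eq_bot] at h
      exact hu (Subtype.ext (h u u.2))
  have hext {f g : End k V} (h : ∀ u ∈ U, f u = g u) : f = g :=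
    LinearMap.ext_on hspan h
  have hfinD : Finite (End R U) := Finite.of_injective (fun f => (f : U → U)) DFunLike.coe_injective
  let : DivisionRing (End R U) := Module.End.instDivisionRing
  have hcomm (δ ε : End R U) : δ * ε = ε * δ :=
    (Finite.isDomain_to_isField (End R U)).mul_comm δ ε
  have hdens (φ : U →+ U) (h : ∀ (δ : End R U) u, φ (δ u) = δ (φ u)) :
      ∃ r : R, ∀ u : U, (φ u : V) = r.1 u := by
    have := Fintype.ofFinite U
    obtain ⟨r, hr⟩ := jacobson_density (R := R) (M := U)
      { φ with map_smul' := fun δ u => h δ u } Finset.univ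
    exact ⟨r, fun u => congrArg Subtype.val (hr u (Finset.mem_univ u))⟩
  -- endomorphisms of `U` are scalars
  have hscal (δ : End R U) : ∃ c ∈ scalarSubfield R, ∀ u : U, (δ u : V) = c • (u : V) := by
    obtain ⟨r, hr⟩ := hdens δ.toAddMonoidHom
      fun ε u => congrArg (fun f : End R U => f u) (hcomm δ ε)
    change ∀ u : U, (δ u : V) = r.1 u at hr
    obtain ⟨c, hc⟩ := Module.End.exists_eigenvalue r.1
    have hrs (s : R) : r.1 * s.1 = s.1 * r.1 := by
      refine hext fun u hu => ?_
      have h1 := hr (s • ⟨u, hu⟩)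
      rw [map_smul] at h1
      have h2 := hr ⟨u, hu⟩
      simp only [End.mul_apply]
      rw [← h2]
      exact h1.symm
    have htop : Module.End.eigenspace r.1 c = ⊤ := by
      refine (hirr _ ?_).resolve_left hc
      intro f hf x hx
      rw [Module.End.mem_eigenspace_iff] at hx ⊢
      have := congrArg (fun g : End k V => g x) (hrs ⟨f, hf⟩)
      simp only [End.mul_apply] at this
      rw [this, hx, map_smul]
    have hrc (x : V) : r.1 x = c • x :=
      Module.End.mem_eigenspace_iff.1 (htop ▸ Submodule.mem_top)
    refine ⟨c, ?_, fun u => (hr u).trans (hrc u)⟩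
    have : algebraMap k (End k V) c = r.1 := by
      ext x; simp [hrc]
    rw [mem_scalarSubfield, this]
    exact r.2
  let F := scalarSubfield R
  let UF : Submodule F V :=
    { U with
      smul_mem' := fun c x hx => by
        have := U.smul_mem (⟨_, (mem_scalarSubfield R).1 c.2⟩ : R) hx
        exact this }
  have : Finite UF := hUfin
  have hdensF (φ : UF →ₗ[F] UF) : ∃ r : R, ∀ u : UF, (φ u : V) = r.1 u := by
    refine hdens φ.toAddMonoidHom fun δ u => ?_
    obtain ⟨c, hcF, hc⟩ := hscal δ
    have h1 : δ u = (⟨c, hcF⟩ : F) • (show UF from u) := Subtype.ext (hc u)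
    have h2 : δ (φ u) = (⟨c, hcF⟩ : F) • φ u := Subtype.ext (hc _)
    change φ (δ u) = δ (φ u)
    rw [h2, h1]
    exact map_smul φ _ _
  let b₀ := Module.finBasis F UF
  have hli : LinearIndependent k (fun i => (b₀ i : V)) := by
    rw [Fintype.linearIndependent_iff]
    intro c hc j
    obtain ⟨r, hr⟩ := hdensF (b₀.constr F (fun i => if i = j then b₀ j else 0))
    have h1 (i) : r.1 (b₀ i) = if i = j then (b₀ j : V) else 0 := by
      rw [← hr, Basis.constr_basis]; split_ifs <;> rfl
    have h2 := congrArg r.1 hc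
    simp only [map_sum, map_smul, h1, map_zero, smul_ite, smul_zero, Finset.sum_ite_eq',
      Finset.mem_univ, if_true] at h2
    refine (smul_eq_zero.1 h2).resolve_right fun h => b₀.ne_zero j (Subtype.ext h)
  have hsp : ⊤ ≤ Submodule.span k (Set.range fun i => (b₀ i : V)) := by
    rw [← hspan, Submodule.span_le]
    intro u hu
    have := b₀.sum_repr (⟨u, hu⟩ : UF)
    have h2 := congrArg Subtype.val this
    simp only [Submodule.coe_sum, Submodule.coe_smul] at h2
    rw [← h2]
    exact Submodule.sum_mem _ fun i _ =>
      Submodule.smul_mem _ (b₀.repr (⟨u, hu⟩ : UF) i : k) (Submodule.subset_span ⟨i, rfl⟩)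
  let b := Basis.mk hli hsp
  have hb (i) : b i = b₀ i := by simp [b]
  have hcoord (u : UF) (i) : b.repr u i = b₀.repr u i := by
    have h2 := congrArg Subtype.val (b₀.sum_repr u)
    simp only [Submodule.coe_sum, Submodule.coe_smul] at h2
    have h3 : (u : V) = ∑ i, (b₀.repr u i : k) • b i := by
      rw [← h2]; exact Finset.sum_congr rfl fun i _ => by rw [hb]; rfl
    rw [h3, Basis.repr_sum_self]
  have hmem (f : End k V) : f ∈ R ↔ ∀ i j, b.repr (f (b j)) i ∈ F := by
    constructor
    · intro hf i j
      have : f (b j) ∈ UF := by rw [hb]; exact U.smul_mem ⟨f, hf⟩ (b₀ j).2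
      rw [hcoord ⟨_, this⟩]
      exact Subtype.prop _
    · intro h
      obtain ⟨r, hr⟩ := hdensF (b₀.constr F (fun j => ∑ i, (⟨_, h i j⟩ : F) • b₀ i))
      suffices f = r.1 from this ▸ r.2
      refine b.ext fun j => ?_
      have h1 := hr (b₀ j)
      rw [Basis.constr_basis] at h1
      rw [(congrArg r.1 (hb j)).trans h1.symm]
      refine (b.sum_repr _).symm.trans ?_
      simp only [Submodule.coe_sum, Submodule.coe_smul]
      exact Finset.sum_congr rfl fun i _ => congrArg (b.repr (f (b j)) i • ·) (hb i)
  have hcard := finrank_eq_card_basis b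
  rw [Fintype.card_fin] at hcard
  refine ⟨b.reindex (finCongr hcard.symm), fun f => (hmem f).trans ?_⟩
  rw [← (finCongr hcard.symm).forall_congr_right]
  refine forall_congr' fun i => ?_
  rw [← (finCongr hcard.symm).forall_congr_right]
  simp [F]
end


section
variable {k X : Type*} [Field k] [Ring X] [Algebra k X]

/-- The products of at most `m` elements of `S`. -/
def wordsOfLength (S : Set X) (m : ℕ) : Set X :=
  {x | ∃ l : List X, l.length ≤ m ∧ (∀ y ∈ l, y ∈ S) ∧ x = l.prod}

theorem one_mem_wordsOfLength (S : Set X) (m : ℕ) : 1 ∈ wordsOfLength S m :=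
  ⟨[], by simp⟩

theorem mul_mem_wordsOfLength {S : Set X} {m n : ℕ} {x y : X} (hx : x ∈ wordsOfLength S m)
    (hy : y ∈ wordsOfLength S n) : x * y ∈ wordsOfLength S (m + n) := by
  obtain ⟨l, hl, hlS, rfl⟩ := hx
  obtain ⟨l', hl', hlS', rfl⟩ := hy
  refine ⟨l ++ l', by simp; omega, fun y hy => ?_, by simp⟩
  rcases List.mem_append.1 hy with h | h
  exacts [hlS y h, hlS' y h]

theorem mem_wordsOfLength_one {S : Set X} {x : X} (hx : x ∈ S) : x ∈ wordsOfLength S 1 :=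
  ⟨[x], by simp [hx]⟩

theorem wordsOfLength_mono (S : Set X) {m n : ℕ} (h : m ≤ n) :
    wordsOfLength S m ⊆ wordsOfLength S n :=
  fun _ ⟨l, hl, hlS⟩ => ⟨l, hl.trans h, hlS⟩

/-- A set containing `1` and stable under left multiplication by `S` contains the submonoid generated
by `S`. -/
theorem closure_subset_of_mul_mem {S N : Set X} (h1 : 1 ∈ N)
    (hmul : ∀ s ∈ S, ∀ x ∈ N, s * x ∈ N) : (Submonoid.closure S : Set X) ⊆ N := by
  intro x hx
  induction hx using Submonoid.closure_induction_left with
  | one => exact h1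
  | mul_left s hs x _ hx => exact hmul s hs x hx

/-- If the words in `S` span the algebra, those of length less than its dimension already do. -/
theorem span_wordsOfLength_eq_top [FiniteDimensional k X] {S : Set X}
    (hS : Submodule.span k (Submonoid.closure S : Set X) = ⊤) {m : ℕ}
    (hm : finrank k X ≤ m + 1) : Submodule.span k (wordsOfLength S m) = ⊤ := by
  have key (m : ℕ) : Submodule.span k (wordsOfLength S m) = ⊤ ∨
      m + 1 ≤ finrank k (Submodule.span k (wordsOfLength S m)) := by
    induction m with
    | zero =>
      rcases subsingleton_or_nontrivial X with h | h
      · exact .inl (Subsingleton.elim _ _)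
      · right
        have := Submodule.nontrivial_iff_ne_bot.2 fun h : Submodule.span k (wordsOfLength S 0) = ⊥ =>
          one_ne_zero (Submodule.span_eq_bot.1 h 1 (one_mem_wordsOfLength S 0))
        exact finrank_pos
    | succ m ih =>
      rcases ih with h | h
      · left
        rw [eq_top_iff, ← h]
        exact Submodule.span_mono (wordsOfLength_mono S m.le_succ)
      · rcases (Submodule.span_mono (R := k) (wordsOfLength_mono S m.le_succ)).eq_or_lt with h' | h'
        · left
          rw [← h', eq_top_iff, ← hS, Submodule.span_le]
          refine closure_subset_of_mul_mem (Submodule.subset_span (one_mem_wordsOfLength S m)) ?_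
          intro s hs x hx
          have : (Submodule.span k (wordsOfLength S m)) ≤
              (Submodule.span k (wordsOfLength S (m + 1))).comap (LinearMap.mulLeft k s) := by
            rw [Submodule.span_le]
            intro y hy
            refine Submodule.subset_span ?_
            rw [add_comm]
            exact mul_mem_wordsOfLength (mem_wordsOfLength_one hs) hy
          rw [SetLike.mem_coe, h']
          exact this hx
        · right
          exact h.trans_lt (Submodule.finrank_lt_finrank_of_lt h')
  rcases key m with h | h
  · exact h
  · exact Submodule.eq_top_of_finrank_eq (le_antisymm (Submodule.finrank_le _) (hm.trans h))

/-- An element whose pairings with a basis lie in a subfield `E`, over which the Gram matrix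
of the basis is defined, is an `E`-combination of the basis. -/
theorem mem_span_of_forall_pairing_mem {ι : Type*} [Finite ι] (b : Basis ι k X) (τ : X →ₗ[k] k)
    (hτ : ∀ x, (∀ y, τ (x * y) = 0) → x = 0) (E : Subfield k)
    (hG : ∀ i j, τ (b i * b j) ∈ E) {x : X} (hx : ∀ j, τ (x * b j) ∈ E) :
    x ∈ Submodule.span E (Set.range b) := by
  have := Fintype.ofFinite ι
  obtain ⟨ψ, hψ⟩ := LinearMap.exists_leftInverse_of_injective (Algebra.linearMap E k)
    (LinearMap.ker_eq_bot.2 (algebraMap E k).injective)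
  have hψ' (e : E) : ψ (e : k) = e := congrArg (fun f : E →ₗ[E] E => f e) hψ
  have hsum (j) : ∑ i, b.repr x i * τ (b i * b j) = τ (x * b j) := by
    conv_rhs => rw [← b.sum_repr x]
    simp only [Finset.sum_mul, map_sum, smul_mul_assoc, map_smul, smul_eq_mul]
  suffices x = ∑ i, ψ (b.repr x i) • b i by
    rw [this]
    exact Submodule.sum_mem _ fun i _ => Submodule.smul_mem _ _ (Submodule.subset_span ⟨i, rfl⟩)
  rw [← sub_eq_zero]
  refine hτ _ fun y => ?_
  suffices τ ∘ₗ LinearMap.mulLeft k (x - ∑ i, ψ (b.repr x i) • b i) = 0 from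
    congrArg (fun f : X →ₗ[k] k => f y) this
  refine b.ext fun j => ?_
  have h1 := congrArg (fun z => (ψ z : k)) (hsum j)
  have h2 (i) : ψ (b.repr x i * τ (b i * b j)) = (⟨_, hG i j⟩ : E) * ψ (b.repr x i) := by
    rw [mul_comm]; exact map_smul ψ (⟨_, hG i j⟩ : E) _
  simp only [map_sum, h2] at h1
  have h1 := h1.trans (congrArg Subtype.val (hψ' ⟨_, hx j⟩))
  change _ = τ (x * b j) at h1
  simp only [LinearMap.comp_apply, LinearMap.mulLeft_apply, sub_mul, map_sub, Finset.sum_mul,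
    map_sum, LinearMap.zero_apply]
  rw [← h1, sub_eq_zero]
  push_cast
  refine Finset.sum_congr rfl fun i _ => ?_
  rw [Subfield.smul_def, smul_mul_assoc, map_smul, smul_eq_mul, mul_comm]

/-- If a nondegenerate linear form takes values in a subfield `E` on the short words in `S`, then it
does so on all words. -/
theorem map_mem_of_mem_closure [FiniteDimensional k X] {S : Set X}
    (hS : Submodule.span k (Submonoid.closure S : Set X) = ⊤) (τ : X →ₗ[k] k)
    (hτ : ∀ x, (∀ y, τ (x * y) = 0) → x = 0) (E : Subfield k)
    (hE : ∀ x ∈ wordsOfLength S (2 * finrank k X), τ x ∈ E) {x : X}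
    (hx : x ∈ Submonoid.closure S) : τ x ∈ E := by
  obtain ⟨m, hm, hm'⟩ : ∃ m, finrank k X ≤ m + 1 ∧ (1 + m + m ≤ 2 * finrank k X ∨ Subsingleton X) := by
    rcases Nat.eq_zero_or_pos (finrank k X) with h | h
    · exact ⟨0, by omega, .inr (finrank_zero_iff.1 h)⟩
    · exact ⟨finrank k X - 1, by omega, .inl (by omega)⟩
  rcases hm' with hm' | _
  swap
  · rw [Subsingleton.elim x 0, map_zero]; exact zero_mem E
  have hE' {x} {n} (hn : n ≤ 1 + m + m) (hx : x ∈ wordsOfLength S n) : τ x ∈ E :=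
    hE x (wordsOfLength_mono S (hn.trans hm') hx)
  let b := Basis.ofSpan (span_wordsOfLength_eq_top hS hm).ge
  have hb (i) : b i ∈ wordsOfLength S m := Basis.ofSpan_subset _ ⟨i, rfl⟩
  have := FiniteDimensional.fintypeBasisIndex b
  have key {x : X} (hx : ∀ j, τ (x * b j) ∈ E) :=
    mem_span_of_forall_pairing_mem b τ hτ E
      (fun i j => hE' (by omega) (mul_mem_wordsOfLength (hb i) (hb j))) hx
  have hN : (Submonoid.closure S : Set X) ⊆ Submodule.span E (Set.range b) := by
    refine closure_subset_of_mul_mem (key fun j => ?_) fun s hs x hx => ?_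
    · rw [one_mul]; exact hE' (by omega) (hb j)
    · induction hx using Submodule.span_induction with
      | mem x hx =>
        obtain ⟨i, rfl⟩ := hx
        exact key fun j => hE' le_rfl
          (mul_mem_wordsOfLength (mul_mem_wordsOfLength (mem_wordsOfLength_one hs) (hb i)) (hb j))
      | zero => simp
      | add x y _ _ hx hy => rw [mul_add]; exact add_mem hx hy
      | smul c x _ hx => rw [mul_smul_comm]; exact Submodule.smul_mem _ _ hx
  have hxN := hN hx
  clear hx
  induction hxN using Submodule.span_induction with
  | mem x hx =>
    obtain ⟨i, rfl⟩ := hx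
    exact hE' (by omega) (hb i)
  | zero => simp
  | add x y _ _ hx hy => rw [map_add]; exact add_mem hx hy
  | smul c x _ hx => rw [Subfield.smul_def, map_smul]; exact mul_mem c.2 hx
end

section
variable {k : Type*} [Field k] {n : Type*} [Fintype n] [DecidableEq n]

/-- A finite set of matrices over an algebraic extension of a finite field generates a finite
algebra. -/
theorem finite_adjoin_matrix (F : Type*) [Field F] [Finite F] [Algebra F k]
    [Algebra.IsAlgebraic F k] {S : Set (Matrix n n k)} (hS : S.Finite) :
    Finite (Algebra.adjoin F S) := by
  have := hS.to_subtype
  let Z : Set k := Set.range fun x : S × n × n => x.1.1 x.2.1 x.2.2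
  have hZ : Finite Z := (Set.finite_range _).to_subtype
  have : FiniteDimensional F (IntermediateField.adjoin F Z) :=
    IntermediateField.finiteDimensional_adjoin fun x _ => Algebra.IsIntegral.isIntegral x
  have : Finite (IntermediateField.adjoin F Z) := Module.finite_of_finite F
  have hle : Algebra.adjoin F S ≤ (IntermediateField.adjoin F Z).val.mapMatrix.range := by
    refine Algebra.adjoin_le fun M hM => ?_
    refine ⟨Matrix.of fun i j => ⟨M i j, IntermediateField.subset_adjoin F Z ⟨(⟨M, hM⟩, i, j), rfl⟩⟩,
      ?_⟩
    ext i j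
    rfl
  exact Set.Finite.to_subtype ((Set.finite_range _).subset hle)

/-- A finite irreducible ring of `d × d` matrices over an algebraically closed field is conjugate to
the ring of matrices over a finite subfield. -/
theorem exists_conj_mem_iff [IsAlgClosed k] {d : ℕ} (hd : 1 ≤ d)
    (A : Subring (Matrix (Fin d) (Fin d) k)) [Finite A]
    (hirr : ∀ W : Submodule k (Fin d → k), (∀ M ∈ A, ∀ x ∈ W, M.mulVec x ∈ W) → W = ⊥ ∨ W = ⊤) :
    ∃ F : Subfield k, (F : Set k).Finite ∧ ∃ g : GL (Fin d) k,
      ∀ M, M ∈ A ↔ ∀ i j, ((g⁻¹ : GL (Fin d) k).1 * M * g.1) i j ∈ F := by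
  have : Nonempty (Fin d) := ⟨⟨0, hd⟩⟩
  let e : Matrix (Fin d) (Fin d) k ≃ₐ[k] End k (Fin d → k) := Matrix.toLinAlgEquiv'
  let R : Subring (End k (Fin d → k)) := A.map e.toRingEquiv.toRingHom
  have hR (M) : e M ∈ R ↔ M ∈ A := by simp [R, Subring.mem_map]
  have : Finite R := Set.Finite.to_subtype ((Set.toFinite (A : Set (Matrix (Fin d) (Fin d) k))).image e)
  obtain ⟨b, hb⟩ := exists_basis_mem_iff R fun W hW => hirr W fun M hM x hx =>
    hW (e M) ((hR M).2 hM) x hx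
  have hcard : finrank k (Fin d → k) = d := by simp
  let b' := b.reindex (finCongr hcard)
  let s := Pi.basisFun k (Fin d)
  refine ⟨scalarSubfield R, ?_, ⟨s.toMatrix b', b'.toMatrix s, by simp, by simp⟩, fun M => ?_⟩
  · exact Set.Finite.of_finite_image (f := algebraMap k (End k (Fin d → k)))
      ((Set.toFinite (R : Set _)).subset (by rintro _ ⟨c, hc, rfl⟩; exact hc))
      (algebraMap k (End k (Fin d → k))).injective.injOn
  · have h1 : b'.toMatrix s * M * s.toMatrix b' = LinearMap.toMatrix b' b' (e M) := by
      rw [← basis_toMatrix_mul_linearMap_toMatrix_mul_basis_toMatrix b' s b' s]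
      congr 2
      exact (LinearMap.toMatrix'_toLin' M).symm
    rw [Units.inv_mk, h1, ← hR, hb, ← (finCongr hcard).forall_congr_right]
    refine forall_congr' fun i => ?_
    rw [← (finCongr hcard).forall_congr_right]
    simp [b', LinearMap.toMatrix_apply]
end

theorem exists_list_map_eq {α β : Type*} (f : α → β) (S : Set α) (l : List β)
    (hl : ∀ y ∈ l, y ∈ f '' S) : ∃ l' : List α, (∀ x ∈ l', x ∈ S) ∧ l'.map f = l := by
  induction l with
  | nil => exact ⟨[], by simp⟩
  | cons y l ih =>
    obtain ⟨l', h, rfl⟩ := ih fun z hz => hl z (List.mem_cons_of_mem _ hz)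
    obtain ⟨x, hx, rfl⟩ := hl _ List.mem_cons_self
    exact ⟨x :: l', by simpa using ⟨hx, h⟩, rfl⟩


/-- Let `p` be a prime, `k` an algebraic closure of `F_p`, `d ≥ 1`, and `S` a finite
subset of `GL_d(k)` generating an irreducible subgroup. Let `E` be the subfield of `k`
generated by the traces of all products of at most `2d²` elements of `S`. Then `E` is
finite, and there is `g ∈ GL_d(k)` such that conjugation `M ↦ g⁻¹ M g` carries the
`F_p`-subalgebra of `M_d(k)` generated by `S` onto the set of matrices with all entries
in `E`; in particular every element of the subgroup generated by `S` is conjugated by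
`g` into a matrix with entries in `E`. -/
theorem stmt_5 {p : ℕ} [Fact p.Prime] {k : Type*} [Field k] [Algebra (ZMod p) k]
    [IsAlgClosure (ZMod p) k] {d : ℕ} (hd : 1 ≤ d)
    (S : Set (GL (Fin d) k)) (hSfin : S.Finite)
    (hirr : ∀ W : Submodule k (Fin d → k),
      (∀ A ∈ S, ∀ x ∈ W, Matrix.mulVec (A : Matrix (Fin d) (Fin d) k) x ∈ W) →
      W = ⊥ ∨ W = ⊤)
    (E : Subfield k)
    (hE : E = Subfield.closure {t : k | ∃ l : List (GL (Fin d) k),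
      l.length ≤ 2 * d ^ 2 ∧ (∀ x ∈ l, x ∈ S) ∧
      t = Matrix.trace (l.map (fun x : GL (Fin d) k =>
        (x : Matrix (Fin d) (Fin d) k))).prod}) :
    (E : Set k).Finite ∧
    ∃ g : GL (Fin d) k,
      ((fun M : Matrix (Fin d) (Fin d) k =>
          ((g⁻¹ : GL (Fin d) k) : Matrix (Fin d) (Fin d) k) * M *
            ((g : GL (Fin d) k) : Matrix (Fin d) (Fin d) k)) ''
        (Algebra.adjoin (ZMod p)
          ((fun A : GL (Fin d) k => (A : Matrix (Fin d) (Fin d) k)) '' S) :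
          Set (Matrix (Fin d) (Fin d) k)) =
        {M : Matrix (Fin d) (Fin d) k | ∀ i j, M i j ∈ E}) ∧
      ∀ T ∈ Subgroup.closure S, ∀ i j,
        ((g⁻¹ * T * g : GL (Fin d) k) : Matrix (Fin d) (Fin d) k) i j ∈ E := by
  let S' : Set (Matrix (Fin d) (Fin d) k) := (fun A : GL (Fin d) k => A.1) '' S
  let A := Algebra.adjoin (ZMod p) S'
  have : IsAlgClosed k := IsAlgClosure.isAlgClosed (ZMod p)
  have : Algebra.IsAlgebraic (ZMod p) k := IsAlgClosure.isAlgebraic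
  have hAfin : Finite A := finite_adjoin_matrix (ZMod p) (hSfin.image _)
  have hS'A : S' ⊆ A := Algebra.subset_adjoin
  have : Finite A.toSubring := hAfin
  obtain ⟨F, hF, g, hg⟩ := exists_conj_mem_iff hd A.toSubring fun W hW =>
    hirr W fun M hM => hW M.1 (hS'A ⟨M, hM, rfl⟩)
  replace hg (M) : M ∈ A ↔ ∀ i j, ((g⁻¹ : GL (Fin d) k).1 * M * g.1) i j ∈ F := hg M
  have hgg : (g⁻¹ : GL (Fin d) k).1 * g.1 = 1 := g.inv_mul
  have hgg' : g.1 * (g⁻¹ : GL (Fin d) k).1 = 1 := g.mul_inv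
  have hconj (N : Matrix (Fin d) (Fin d) k) :
      (g⁻¹ : GL (Fin d) k).1 * (g.1 * N * (g⁻¹ : GL (Fin d) k).1) * g.1 = N := by
    simp only [mul_assoc, hgg, mul_one]
    rw [← mul_assoc, hgg, one_mul]
  have hmem {N : Matrix (Fin d) (Fin d) k} (hN : ∀ i j, N i j ∈ F) :
      g.1 * N * (g⁻¹ : GL (Fin d) k).1 ∈ A := by
    rw [hg, hconj]; exact hN
  have hsingle {c : k} (hc : c ∈ F) (i₀ j₀ : Fin d) :
      g.1 * Matrix.single i₀ j₀ c * (g⁻¹ : GL (Fin d) k).1 ∈ A :=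
    hmem fun i j => by
      rw [Matrix.single_apply]; split_ifs
      exacts [hc, zero_mem F]
  have htr (M : Matrix (Fin d) (Fin d) k) :
      Matrix.trace (g.1 * M * (g⁻¹ : GL (Fin d) k).1) = Matrix.trace M := by
    rw [Matrix.trace_mul_comm, ← mul_assoc, hgg, one_mul]
  have hadj : Subalgebra.toSubmodule A = Submodule.span (ZMod p) (Submonoid.closure S') :=
    Algebra.adjoin_eq_span _ _
  have hspan : Submodule.span k (Submonoid.closure S' : Set (Matrix (Fin d) (Fin d) k)) = ⊤ := by
    have hA {M} (hM : M ∈ A) : M ∈ Submodule.span k (Submonoid.closure S' : Set _) := by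
      rw [← Subalgebra.mem_toSubmodule, hadj] at hM
      exact Submodule.span_le_restrictScalars (ZMod p) k _ hM
    rw [eq_top_iff]
    intro M _
    have hM : M = g.1 * ((g⁻¹ : GL (Fin d) k).1 * M * g.1) * (g⁻¹ : GL (Fin d) k).1 := by
      simp only [mul_assoc, hgg', mul_one]
      rw [← mul_assoc, hgg', one_mul]
    rw [hM]
    generalize (g⁻¹ : GL (Fin d) k).1 * M * g.1 = N
    rw [Matrix.matrix_eq_sum_single N]
    simp only [Finset.mul_sum, Finset.sum_mul]
    refine Submodule.sum_mem _ fun i _ => Submodule.sum_mem _ fun j _ => ?_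
    have hN : Matrix.single i j (N i j) = N i j • Matrix.single i j 1 := by
      rw [Matrix.smul_single, smul_eq_mul, mul_one]
    rw [hN, mul_smul_comm, smul_mul_assoc]
    exact Submodule.smul_mem _ _ (hA (hsingle (one_mem F) i j))
  have hclos {M} (hM : M ∈ Submonoid.closure S') : Matrix.trace M ∈ E := by
    refine map_mem_of_mem_closure hspan (Matrix.traceLinearMap (Fin d) k k) ?_ E ?_ hM
    · intro x hx
      refine Matrix.ext_iff_trace_mul_right.2 fun y => ?_
      simpa using hx y
    · rintro _ ⟨l, hl, hlS, rfl⟩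
      obtain ⟨l', hl', rfl⟩ := exists_list_map_eq _ S l hlS
      rw [hE]
      refine Subfield.subset_closure ⟨l', ?_, hl', rfl⟩
      simpa [Module.finrank_matrix, sq] using hl
  have htrA {M} (hM : M ∈ A) : Matrix.trace M ∈ E := by
    rw [← Subalgebra.mem_toSubmodule, hadj] at hM
    induction hM using Submodule.span_induction with
    | mem x hx => exact hclos hx
    | zero => simp
    | add x y _ _ hx hy => rw [Matrix.trace_add]; exact add_mem hx hy
    | smul c x _ hx =>
      rw [Matrix.trace_smul, ← ZMod.natCast_zmod_val c, Nat.cast_smul_eq_nsmul]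
      exact nsmul_mem hx _
  have hEF : E = F := by
    apply le_antisymm
    · rw [hE, Subfield.closure_le]
      rintro _ ⟨l, -, hl, rfl⟩
      have hlA : (l.map fun x : GL (Fin d) k => x.1).prod ∈ A :=
        list_prod_mem fun y hy => by
          obtain ⟨x, hx, rfl⟩ := List.mem_map.1 hy
          exact hS'A ⟨x, hl x hx, rfl⟩
      have h := (hg _).1 hlA
      have h2 : Matrix.trace ((g⁻¹ : GL (Fin d) k).1 * (l.map fun x : GL (Fin d) k => x.1).prod * g.1)
          ∈ F := sum_mem fun i _ => h i i
      rw [Matrix.trace_mul_comm, ← mul_assoc, hgg', one_mul] at h2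
      exact h2
    · intro c hc
      have h := htrA (hsingle hc ⟨0, hd⟩ ⟨0, hd⟩)
      rwa [htr, Matrix.trace_single_eq_same] at h
  subst hEF
  refine ⟨hF, g, ?_, ?_⟩
  · ext N
    constructor
    · rintro ⟨M, hM, rfl⟩
      exact (hg M).1 hM
    · intro hN
      exact ⟨_, hmem hN, hconj N⟩
  · intro T hT
    suffices T.1 ∈ A by simpa using (hg _).1 this
    induction hT using Subgroup.closure_induction with
    | mem x hx => exact hS'A ⟨x, hx, rfl⟩
    | one => exact one_mem A
    | mul x y _ _ hx hy => exact mul_mem hx hy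
    | inv x _ hx =>
      have hinj : Function.Injective (fun y : A => (⟨_, hx⟩ : A) * y) := fun y z hyz =>
        Subtype.ext (x.isUnit.mul_left_cancel (congrArg Subtype.val hyz))
      obtain ⟨y, hy⟩ := Finite.surjective_of_injective hinj 1
      rw [Units.inv_eq_of_mul_eq_one_right (congrArg Subtype.val hy)]
      exact y.2
end

section
/- Let A be an integral domain of characteristic 0 that is a finitely generated ℤ-algebra, let s be the transcendence degree of the fraction field of A over ℚ, and let g ∈ A be transcendental over ℚ. Then there exist a real constant c > 0 and a positive integer m such that for every finite field F whose characteristic does not divide m, and for every t ∈ F, the number of ring homomorphisms φ : A → F with φ(g) = t is finite and at most c·|F|^{s−1}. -/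
open Algebra

universe u

theorem RingHom.ext_of_adjoin_int_eq_top {A B : Type*} [CommRing A] [CommRing B] {X : Set A}
    (hX : adjoin ℤ X = ⊤) {φ ψ : A →+* B} (h : Set.EqOn φ ψ X) : φ = ψ := by
  have := AlgHom.ext_of_adjoin_eq_top (φ₁ := φ.toIntAlgHom) (φ₂ := ψ.toIntAlgHom) hX h
  ext a
  exact DFunLike.congr_fun this a

instance RingHom.finite_of_finiteType_int {A F : Type*} [CommRing A] [Algebra.FiniteType ℤ A]
    [CommRing F] [_root_.Finite F] : _root_.Finite (A →+* F) := by
  obtain ⟨X, hX⟩ := Algebra.FiniteType.out (R := ℤ) (A := A)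
  exact _root_.Finite.of_injective (fun (φ : A →+* F) (x : X) => φ x) fun φ ψ h =>
    ext_of_adjoin_int_eq_top hX fun x hx => congrFun h ⟨x, hx⟩

/-- If `A` is algebraic over `ℤ[T]` then, outside a hypersurface `a = 0`, boundedly many
homomorphisms from `A` to a finite field share the same values on `T`. -/
theorem exists_ncard_extensions_le {A : Type*} [CommRing A] [IsDomain A]
    [Algebra.FiniteType ℤ A] (T : Set A) [Algebra.IsAlgebraic (adjoin ℤ T) A] :
    ∃ a : A, a ≠ 0 ∧ ∃ D : ℕ, ∀ (F : Type) [Field F] [Finite F] (φ₀ : A →+* F),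
      {φ : A →+* F | φ a ≠ 0 ∧ Set.EqOn φ φ₀ T}.ncard ≤ D := by
  classical
  obtain ⟨X, hX⟩ := Algebra.FiniteType.out (R := ℤ) (A := A)
  choose f hf0 hf using fun x : A => Algebra.IsAlgebraic.isAlgebraic (R := adjoin ℤ T) x
  refine ⟨∏ x : X, ((f x).leadingCoeff : A), ?_, ∏ x : X, (f x).natDegree, ?_⟩
  · simp [Finset.prod_eq_zero_iff, hf0]
  intro F _ _ φ₀
  have hres : ∀ φ : A →+* F, Set.EqOn φ φ₀ T →
      φ.comp (algebraMap (adjoin ℤ T) A) = φ₀.comp (algebraMap (adjoin ℤ T) A) := by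
    intro φ h
    ext b
    exact AlgHom.adjoin_le_equalizer φ.toIntAlgHom φ₀.toIntAlgHom h b.2
  set ψ := φ₀.comp (algebraMap (adjoin ℤ T) A)
  by_cases hne : ∀ x : X, (f x).map ψ ≠ 0
  · let R : Finset (X → F) := Fintype.piFinset fun x : X => ((f x).map ψ).roots.toFinset
    have hR : R.card ≤ ∏ x : X, (f x).natDegree := by
      rw [Fintype.card_piFinset]
      refine Finset.prod_le_prod' fun x _ => ?_
      exact (Multiset.toFinset_card_le _).trans
        ((Polynomial.card_roots' _).trans Polynomial.natDegree_map_le)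
    refine le_trans ?_ hR
    rw [← Set.ncard_coe_finset]
    refine Set.ncard_le_ncard_of_injOn (fun φ x => φ x) ?_ ?_
    · rintro φ ⟨-, hφ⟩
      simp only [R, Finset.mem_coe, Fintype.mem_piFinset, Multiset.mem_toFinset]
      intro x
      rw [Polynomial.mem_roots (hne x), Polynomial.IsRoot, Polynomial.eval_map, ← hres φ hφ,
        ← Polynomial.hom_eval₂, ← Polynomial.aeval_def, hf, map_zero]
    · exact fun φ _ φ' _ h =>
        RingHom.ext_of_adjoin_int_eq_top hX fun x hx => congrFun h ⟨x, hx⟩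
  · push Not at hne
    obtain ⟨x, hx⟩ := hne
    suffices {φ : A →+* F | φ (∏ x : X, ((f x).leadingCoeff : A)) ≠ 0 ∧ Set.EqOn φ φ₀ T} = ∅ by
      rw [this, Set.ncard_empty]
      exact Nat.zero_le _
    refine Set.eq_empty_of_forall_notMem fun φ ⟨hφ, hT⟩ => ?_
    rw [map_prod, Finset.prod_ne_zero_iff] at hφ
    apply hφ x (Finset.mem_univ _)
    have := congrArg (Polynomial.coeff · (f x).natDegree) hx
    rw [← hres φ hT] at this
    simpa using this

theorem exists_ncard_specializations_le {A : Type*} [CommRing A] [IsDomain A]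
    [Algebra.FiniteType ℤ A] (g : A) (T : Set A) (hT : T.Finite)
    [Algebra.IsAlgebraic (adjoin ℤ (insert g T)) A] :
    ∃ a : A, a ≠ 0 ∧ ∃ D : ℕ, ∀ (F : Type) [Field F] [Finite F] (t : F),
      {φ : A →+* F | φ a ≠ 0 ∧ φ g = t}.ncard ≤ D * Nat.card F ^ T.ncard := by
  classical
  obtain ⟨a, ha, D, hD⟩ := exists_ncard_extensions_le (insert g T)
  refine ⟨a, ha, D, fun F _ _ t => ?_⟩
  have := hT.fintype
  have := Fintype.ofFinite F
  have := Fintype.ofFinite (A →+* F)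
  have key := Finset.card_le_mul_card_image_of_maps_to
    (s := {φ : A →+* F | φ a ≠ 0 ∧ φ g = t}.toFinset) (f := fun φ (x : T) => φ x)
    (t := Finset.univ) (fun _ _ => Finset.mem_univ _) D ?_
  · rw [Set.ncard_eq_toFinset_card', Nat.card_eq_fintype_card]
    simpa only [Finset.card_univ, Fintype.card_fun, ← Nat.card_eq_fintype_card (α := T),
      Nat.card_coe_set_eq] using key
  intro τ _
  obtain h | ⟨φ₀, hφ₀⟩ := Finset.eq_empty_or_nonempty
    {φ ∈ {φ : A →+* F | φ a ≠ 0 ∧ φ g = t}.toFinset | (fun x : T => φ x) = τ}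
  · rw [h, Finset.card_empty]
    exact Nat.zero_le _
  refine le_trans ?_ (hD F φ₀)
  rw [← Set.ncard_coe_finset]
  refine Set.ncard_le_ncard ?_
  simp only [Set.mem_toFinset, Set.mem_ofPred_eq, Finset.mem_filter] at hφ₀
  intro φ hφ
  simp only [Set.mem_toFinset, Set.mem_ofPred_eq, Finset.coe_filter] at hφ
  refine ⟨hφ.1.1, ?_⟩
  rintro x (rfl | hx)
  · rw [hφ.1.2, hφ₀.1.2]
  · exact congrFun (hφ.2.trans hφ₀.2.symm) ⟨x, hx⟩

theorem AlgHom.trdeg_lt_of_surjective {R : Type*} {A B : Type u} [CommRing R] [CommRing A]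
    [IsDomain A] [CommRing B] [IsDomain B] [Algebra R A] [Algebra R B] [FaithfulSMul R B]
    (hfin : trdeg R A < Cardinal.aleph0) (f : A →ₐ[R] B) (hf : Function.Surjective f)
    {a : A} (ha : a ≠ 0) (hfa : f a = 0) : trdeg R B < trdeg R A := by
  by_contra! hle
  obtain ⟨s, hs⟩ := exists_isTranscendenceBasis R B
  choose y hy using fun x : s => hf x
  have hcomp : f ∘ y = ((↑) : s → B) := funext hy
  have hindf : AlgebraicIndependent R (f ∘ y) := hcomp ▸ hs.1
  have hind : AlgebraicIndependent R y := .of_comp f hindf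
  have : Nontrivial R := (algebraMap R B).domain_nontrivial
  have := (hind.isTranscendenceBasis_of_trdeg_le hfin
    (hle.trans_eq hs.cardinalMk_eq_trdeg.symm)).isAlgebraic
  obtain ⟨⟨r, hr⟩, hr0, har⟩ :=
    (Algebra.IsAlgebraic.isAlgebraic (R := adjoin R (Set.range y)) a).exists_nonzero_dvd
      (mem_nonZeroDivisors_of_ne_zero ha)
  rw [Algebra.adjoin_range_eq_range_aeval] at hr
  obtain ⟨p, rfl⟩ := hr
  have h0 : MvPolynomial.aeval (f ∘ y) p = 0 := by
    rw [Function.comp_def, ← MvPolynomial.comp_aeval_apply]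
    exact zero_dvd_iff.mp (hfa ▸ map_dvd f har)
  exact hr0 (Subtype.ext (by simp [hindf.eq_zero_of_aeval_eq_zero _ h0]))

theorem Algebra.FiniteType.of_surjective_int {A B : Type*} [CommRing A] [CommRing B]
    [Algebra.FiniteType ℤ A] (f : A →+* B) (hf : Function.Surjective f) : Algebra.FiniteType ℤ B :=
  .of_surjective f.toIntAlgHom hf

/-- The number of points of `A` over finite fields `F`, of characteristic outside a finite set,
is `O(|F| ^ d)`. -/
def HasPointBound (A : Type*) [CommRing A] (d : ℕ) : Prop :=
  ∃ c m : ℕ, 0 < m ∧ ∀ (F : Type) [Field F] [Finite F], ¬ ringChar F ∣ m →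
    Nat.card (A →+* F) ≤ c * Nat.card F ^ d

theorem HasPointBound.of_ringChar_ne_zero {A : Type*} [CommRing A] (h : ringChar A ≠ 0) (d : ℕ) :
    HasPointBound A d := by
  refine ⟨0, ringChar A, Nat.pos_of_ne_zero h, fun F _ _ hF => ?_⟩
  have : IsEmpty (A →+* F) := ⟨fun φ => hF <| ringChar.dvd <| by
    rw [← map_natCast φ, ringChar.Nat.cast_ringChar, map_zero]⟩
  simp

theorem exists_ncard_vanishing_le {A : Type*} [CommRing A] [Algebra.FiniteType ℤ A] (a : A) (d : ℕ)
    (h : ∀ P : Ideal A, P.IsPrime → a ∈ P → HasPointBound (A ⧸ P) d) :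
    ∃ c m : ℕ, 0 < m ∧ ∀ (F : Type) [Field F] [Finite F], ¬ ringChar F ∣ m →
      {φ : A →+* F | φ a = 0}.ncard ≤ c * Nat.card F ^ d := by
  have : IsNoetherianRing A := Algebra.FiniteType.isNoetherianRing ℤ A
  have := ((Ideal.span {a}).finite_minimalPrimes_of_isNoetherianRing A).fintype
  choose c m hm hc using fun P : (Ideal.span {a}).minimalPrimes =>
    h P P.2.1.1 (P.2.1.2 (Ideal.mem_span_singleton_self a))
  refine ⟨∑ P, c P, ∏ P, m P, Finset.prod_pos fun P _ => hm P, fun F _ _ hF => ?_⟩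
  have hsub : {φ : A →+* F | φ a = 0} ⊆ ⋃ P : (Ideal.span {a}).minimalPrimes,
      Set.range fun φ : A ⧸ P.1 →+* F => φ.comp (Ideal.Quotient.mk P.1) := by
    intro φ hφ
    have hker : Ideal.span {a} ≤ RingHom.ker φ := by simpa [Ideal.span_le] using hφ
    have : (RingHom.ker φ).IsPrime := RingHom.ker_isPrime φ
    obtain ⟨P, hP, hPφ⟩ := Ideal.exists_minimalPrimes_le hker
    exact Set.mem_iUnion.mpr ⟨⟨P, hP⟩, Ideal.Quotient.lift P φ hPφ,
      Ideal.Quotient.lift_comp_mk P φ hPφ⟩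
  refine (Set.ncard_le_ncard hsub).trans ((Set.ncard_iUnion_le_of_fintype _).trans ?_)
  rw [Finset.sum_mul]
  refine Finset.sum_le_sum fun P _ => ?_
  refine le_trans ?_ (hc P F fun hP => hF (hP.trans (Finset.dvd_prod_of_mem m (Finset.mem_univ P))))
  have := Algebra.FiniteType.of_surjective_int _ (Ideal.Quotient.mk_surjective (I := P.1))
  rw [← Set.image_univ, ← Set.ncard_univ]
  exact Set.ncard_image_le

theorem exists_ncard_vanishing_le_of_trdeg_lt {A : Type u} [CommRing A] [IsDomain A]
    [Algebra.FiniteType ℤ A] {a : A} (ha : a ≠ 0) (d : ℕ)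
    (h : ∀ (B : Type u) [CommRing B] [IsDomain B] [CharZero B] [Algebra.FiniteType ℤ B],
      trdeg ℤ B < trdeg ℤ A → HasPointBound B d) :
    ∃ c m : ℕ, 0 < m ∧ ∀ (F : Type) [Field F] [Finite F], ¬ ringChar F ∣ m →
      {φ : A →+* F | φ a = 0}.ncard ≤ c * Nat.card F ^ d := by
  refine exists_ncard_vanishing_le a _ fun P hP haP => ?_
  by_cases hchar : ringChar (A ⧸ P) = 0
  · have := (CharP.ringChar_zero_iff_CharZero (A ⧸ P)).mp hchar
    have := Algebra.FiniteType.of_surjective_int _ (Ideal.Quotient.mk_surjective (I := P))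
    exact h _ ((Ideal.Quotient.mk P).toIntAlgHom.trdeg_lt_of_surjective
      (trdeg_lt_aleph0_of_finiteType ..) Ideal.Quotient.mk_surjective ha
      (Ideal.Quotient.eq_zero_iff_mem.mpr haP))
  · exact .of_ringChar_ne_zero hchar _

/-- The fibers of `g` are bounded by splitting off a hypersurface, whose components have smaller
transcendence degree. -/
theorem exists_ncard_fiber_le {A : Type u} [CommRing A] [IsDomain A] [Algebra.FiniteType ℤ A]
    (g : A) (T : Set A) (hT : T.Finite) [Algebra.IsAlgebraic (adjoin ℤ (insert g T)) A] (d : ℕ)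
    (h : ∀ (B : Type u) [CommRing B] [IsDomain B] [CharZero B] [Algebra.FiniteType ℤ B],
      trdeg ℤ B < trdeg ℤ A → HasPointBound B d) :
    ∃ c m : ℕ, 0 < m ∧ ∀ (F : Type) [Field F] [Finite F], ¬ ringChar F ∣ m → ∀ t : F,
      {φ : A →+* F | φ g = t}.ncard ≤ c * Nat.card F ^ max T.ncard d := by
  obtain ⟨a, ha, D, hD⟩ := exists_ncard_specializations_le g T hT
  obtain ⟨c, m, hm, hc⟩ := exists_ncard_vanishing_le_of_trdeg_lt ha d h
  refine ⟨D + c, m, hm, fun F _ _ hF t => ?_⟩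
  have hsub : {φ : A →+* F | φ g = t} ⊆
      {φ : A →+* F | φ a ≠ 0 ∧ φ g = t} ∪ {φ : A →+* F | φ a = 0} := fun φ hφ =>
    (em (φ a = 0)).elim .inr fun h => .inl ⟨h, hφ⟩
  calc _ ≤ D * Nat.card F ^ T.ncard + c * Nat.card F ^ d :=
        (Set.ncard_le_ncard hsub).trans ((Set.ncard_union_le _ _).trans
          (add_le_add (hD F t) (hc F hF)))
    _ ≤ D * Nat.card F ^ max T.ncard d + c * Nat.card F ^ max T.ncard d := by
        gcongr <;> first | exact Nat.card_pos | simp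
    _ = _ := (add_mul ..).symm

theorem IsTranscendenceBasis.finite_and_ncard_eq {R A : Type*} [CommRing R] [CommRing A]
    [NoZeroDivisors A] [Nontrivial R] [Algebra R A] {T : Set A}
    (hT : IsTranscendenceBasis R ((↑) : T → A)) {s : ℕ} (hs : trdeg R A = s) :
    T.Finite ∧ T.ncard = s := by
  have h := hT.cardinalMk_eq_trdeg.trans hs
  refine ⟨Cardinal.lt_aleph0_iff_set_finite.mp (h ▸ Cardinal.natCast_lt_aleph0), ?_⟩
  rw [← Nat.card_coe_set_eq, Nat.card, h, Cardinal.toNat_natCast]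

theorem hasPointBound_of_trdeg_le (s : ℕ) (A : Type u) [CommRing A] [IsDomain A] [CharZero A]
    [Algebra.FiniteType ℤ A] (hA : trdeg ℤ A ≤ s) : HasPointBound A s := by
  induction s using Nat.strong_induction_on generalizing A with
  | h s ih =>
  obtain ⟨T, hT⟩ := exists_isTranscendenceBasis ℤ A
  obtain ⟨k, hk⟩ := Cardinal.lt_aleph0.mp (trdeg_lt_aleph0_of_finiteType (R := ℤ) (S := A))
  obtain ⟨hTfin, hTcard⟩ := hT.finite_and_ncard_eq hk
  rw [hk, Nat.cast_le] at hA
  have : Algebra.IsAlgebraic (adjoin ℤ (insert 0 T)) A := by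
    rw [adjoin_insert_zero]
    exact Subtype.range_coe (s := T) ▸ hT.isAlgebraic
  obtain ⟨c, m, hm, h⟩ := exists_ncard_fiber_le 0 T hTfin (s - 1) fun B _ _ _ _ hB => by
    obtain ⟨l, hl⟩ := Cardinal.lt_aleph0.mp (trdeg_lt_aleph0_of_finiteType (R := ℤ) (S := B))
    rw [hl, hk, Nat.cast_lt] at hB
    exact ih (s - 1) (by omega) B (by rw [hl, Nat.cast_le]; omega)
  refine ⟨c, m, hm, fun F _ _ hF => ?_⟩
  refine le_trans (by simpa using h F hF 0) (Nat.mul_le_mul_left c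
    (Nat.pow_le_pow_right Nat.card_pos (max_le (hTcard.trans_le hA) (Nat.sub_le s 1))))

theorem trdeg_int_eq_trdeg_rat (A K : Type u) [CommRing A] [IsDomain A] [CharZero A] [Field K]
    [Algebra A K] [IsFractionRing A K] [Algebra ℚ K] : trdeg ℤ A = trdeg ℚ K := by
  have : CharZero K := algebraRat.charZero K
  have : Algebra.IsAlgebraic A K := IsLocalization.isAlgebraic K (nonZeroDivisors A)
  have : Algebra.IsAlgebraic ℤ ℚ := IsLocalization.isAlgebraic ℚ (nonZeroDivisors ℤ)
  have : FaithfulSMul A K :=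
    (faithfulSMul_iff_algebraMap_injective A K).mpr (IsFractionRing.injective A K)
  have hA : trdeg ℤ A + trdeg A K = trdeg ℤ K := trdeg_add_eq ..
  have hQ := lift_trdeg_add_eq ℤ ℚ K
  rw [trdeg_eq_zero (R := A), add_zero] at hA
  rw [trdeg_eq_zero (R := ℤ) (A := ℚ), Cardinal.lift_zero, zero_add, Cardinal.lift_uzero,
    Cardinal.lift_uzero] at hQ
  rw [hA, hQ]

theorem Transcendental.int_of_rat {A K : Type*} [CommRing A] [Field K] [Algebra A K]
    [Algebra ℚ K] {g : A} (hg : Transcendental ℚ (algebraMap A K g)) : Transcendental ℤ g :=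
  fun h => hg ((h.algebraMap (A := K)).extendScalars (algebraMap ℤ ℚ).injective_int)

/-- Let `A` be an integral domain of characteristic `0` that is a finitely generated
`ℤ`-algebra, let `s` be the transcendence degree of `Frac(A)` over `ℚ`, and let
`g ∈ A` be transcendental over `ℚ`. Then there are `c > 0` and `m ≥ 1` such that for
every finite field `F` whose characteristic does not divide `m` and every `t ∈ F`,
the set of ring homomorphisms `φ : A → F` with `φ(g) = t` is finite of size at most
`c · |F|^(s-1)`. -/
theorem stmt_10 {A : Type*} [CommRing A] [IsDomain A] [CharZero A]
    [Algebra.FiniteType ℤ A] {s : ℕ}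
    (hs : ∃ b : Fin s → FractionRing A, IsTranscendenceBasis ℚ b)
    (g : A) (hg : Transcendental ℚ (algebraMap A (FractionRing A) g)) :
    ∃ (c : ℝ) (m : ℕ), 0 < c ∧ 0 < m ∧
      ∀ (F : Type) [Field F] [Fintype F], ¬ (ringChar F ∣ m) →
        ∀ t : F, {φ : A →+* F | φ g = t}.Finite ∧
          ({φ : A →+* F | φ g = t}.ncard : ℝ) ≤ c * (Fintype.card F : ℝ) ^ (s - 1) := by
  obtain ⟨b, hb⟩ := hs
  have htr : trdeg ℤ A = s := by
    rw [trdeg_int_eq_trdeg_rat A (FractionRing A)]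
    simpa using hb.lift_cardinalMk_eq_trdeg.symm
  have hgind : AlgebraicIndepOn ℤ id {g} := by
    rw [AlgebraicIndepOn, algebraicIndependent_unique_type_iff]
    exact hg.int_of_rat
  obtain ⟨T, hgT, hT⟩ := exists_isTranscendenceBasis_superset hgind
  rw [Set.singleton_subset_iff] at hgT
  obtain ⟨hTfin, hTcard⟩ := hT.finite_and_ncard_eq htr
  have : Algebra.IsAlgebraic (adjoin ℤ (insert g (T \ {g}))) A := by
    rw [Set.insert_sdiff_singleton, Set.insert_eq_of_mem hgT]
    exact Subtype.range_coe (s := T) ▸ hT.isAlgebraic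
  have hpos : 0 < s := hTcard ▸ (Set.ncard_pos hTfin).mpr ⟨g, hgT⟩
  obtain ⟨c, m, hm, h⟩ := exists_ncard_fiber_le g (T \ {g}) hTfin.sdiff (s - 1)
    fun B _ _ _ _ hB => hasPointBound_of_trdeg_le _ B (by
      rw [htr, ← Nat.sub_add_cancel hpos, Nat.cast_succ] at hB
      exact Order.le_of_lt_succ (by simpa using hB))
  rw [Set.ncard_sdiff_singleton_of_mem hgT, hTcard, max_self] at h
  refine ⟨c + 1, m, by positivity, hm, fun F _ _ hF t => ⟨Set.toFinite _, ?_⟩⟩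
  have := h F hF t
  rw [Nat.card_eq_fintype_card] at this
  calc _ ≤ (c : ℝ) * (Fintype.card F : ℝ) ^ (s - 1) := by exact_mod_cast this
    _ ≤ _ := by gcongr; simp
end

section
/- Let A be an integral domain of characteristic 0 that is a finitely generated ℤ-algebra, let s be the transcendence degree of the fraction field of A over ℚ, and let g ∈ A be transcendental over ℚ. Then there exist a real constant c > 0 and a positive integer m such that for every finite field F whose characteristic does not divide m, the number of ring homomorphisms φ : A → F for which the subfield of F generated by φ(g) over the prime field of F is a proper subfield of F is finite and at most c·|F|^{s−1/2}. -/
open MvPolynomial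

theorem mem_adjoin_rat_range_exists_smul {A K : Type*} [CommRing A] [Field K] [Algebra ℚ K]
    (i : A →+* K) {z : K} (hz : z ∈ Algebra.adjoin ℚ (Set.range i)) :
    ∃ (n : ℤ) (a : A), n ≠ 0 ∧ (n : K) * z = i a := by
  induction hz using Algebra.adjoin_induction with
  | mem z hz =>
    obtain ⟨a, rfl⟩ := hz
    exact ⟨1, a, one_ne_zero, by simp⟩
  | algebraMap r =>
    refine ⟨r.den, r.num, by exact_mod_cast r.den_ne_zero, ?_⟩
    have h := congrArg (algebraMap ℚ K) (Rat.den_mul_eq_num r)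
    rw [map_mul, map_natCast, map_intCast] at h
    rw [map_intCast, Int.cast_natCast, h]
  | add z w _ _ hz hw =>
    obtain ⟨n, a, hn, ha⟩ := hz
    obtain ⟨k, b, hk, hb⟩ := hw
    refine ⟨n * k, k * a + n * b, mul_ne_zero hn hk, ?_⟩
    simp only [map_add, map_mul, map_intCast, ← ha, ← hb]
    push_cast
    ring
  | mul z w _ _ hz hw =>
    obtain ⟨n, a, hn, ha⟩ := hz
    obtain ⟨k, b, hk, hb⟩ := hw
    refine ⟨n * k, a * b, mul_ne_zero hn hk, ?_⟩
    simp only [map_mul, ← ha, ← hb]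
    push_cast
    ring

theorem finiteType_adjoin_rat_range {A K : Type*} [CommRing A] [Algebra.FiniteType ℤ A]
    [Field K] [Algebra ℚ K] (i : A →+* K) :
    Algebra.FiniteType ℚ (Algebra.adjoin ℚ (Set.range i)) := by
  classical
  obtain ⟨t, ht⟩ := Algebra.FiniteType.out (R := ℤ) (A := A)
  have h : Algebra.adjoin ℚ (Set.range i) = Algebra.adjoin ℚ (t.image i : Set K) := by
    refine le_antisymm (Algebra.adjoin_le ?_) (Algebra.adjoin_mono ?_)
    · rintro _ ⟨a, rfl⟩
      have ha : a ∈ Algebra.adjoin ℤ (t : Set A) := ht ▸ Algebra.mem_top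
      induction ha using Algebra.adjoin_induction with
      | mem a h => exact Algebra.subset_adjoin (by simpa using ⟨a, h, rfl⟩)
      | algebraMap n => simp
      | add a b _ _ ha hb => rw [map_add]; exact add_mem ha hb
      | mul a b _ _ ha hb => rw [map_mul]; exact mul_mem ha hb
    · simp
  rw [h]
  exact (Subalgebra.fg_iff_finiteType _).1 ⟨_, rfl⟩

/-- Noether normalization of a finitely generated domain over `ℤ`, up to integer factors. -/
theorem exists_algebraicIndependent_int_isIntegralElem {A : Type*} [CommRing A] [IsDomain A]
    [CharZero A] [Algebra.FiniteType ℤ A] :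
    ∃ (r : ℕ) (x : Fin r → A), AlgebraicIndependent ℤ x ∧ ∀ a : A, ∃ n : ℤ, n ≠ 0 ∧
      (aeval x : MvPolynomial (Fin r) ℤ →ₐ[ℤ] A).toRingHom.IsIntegralElem (n * a) := by
  let i := algebraMap A (FractionRing A)
  let R := Algebra.adjoin ℚ (Set.range i)
  have : Algebra.FiniteType ℚ R := finiteType_adjoin_rat_range i
  let j : A →+* R := i.codRestrict R.toSubring fun a => Algebra.subset_adjoin ⟨a, rfl⟩
  have hj : Function.Injective j := fun a b h =>
    IsFractionRing.injective A (FractionRing A) (congrArg Subtype.val h)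
  obtain ⟨r, f, hf, hfi⟩ := exists_integral_inj_algHom_of_fg ℚ R
  have hx (k : Fin r) : ∃ (n : ℤ) (a : A), n ≠ 0 ∧ (n : R) * f (X k) = j a := by
    obtain ⟨n, a, hn, h⟩ := mem_adjoin_rat_range_exists_smul i (f (X k)).2
    exact ⟨n, a, hn, Subtype.ext (by push_cast; exact h)⟩
  choose N x hN hNx using hx
  let e : MvPolynomial (Fin r) ℚ →ₐ[ℚ] MvPolynomial (Fin r) ℚ := aeval fun k => C (N k : ℚ) * X k
  let e' : MvPolynomial (Fin r) ℚ →ₐ[ℚ] MvPolynomial (Fin r) ℚ :=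
    aeval fun k => C (N k : ℚ)⁻¹ * X k
  have hN' (k : Fin r) : (N k : ℚ) ≠ 0 := by exact_mod_cast hN k
  have he₁ : e.comp e' = AlgHom.id _ _ := by
    ext1 k
    simp only [e, e', AlgHom.comp_apply, aeval_X, map_mul, algHom_C, algebraMap_eq, AlgHom.id_apply]
    rw [← mul_assoc, ← map_mul, inv_mul_cancel₀ (hN' k), map_one, one_mul]
  have he₂ : e'.comp e = AlgHom.id _ _ := by
    ext1 k
    simp only [e, e', AlgHom.comp_apply, aeval_X, map_mul, algHom_C, algebraMap_eq, AlgHom.id_apply]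
    rw [← mul_assoc, ← map_mul, mul_inv_cancel₀ (hN' k), map_one, one_mul]
  have heinj : Function.Injective e := fun a b h => by
    simpa using (DFunLike.congr_fun he₂ a).symm.trans
      ((congrArg e' h).trans (DFunLike.congr_fun he₂ b))
  have hesurj : Function.Surjective e := fun a => ⟨e' a, DFunLike.congr_fun he₁ a⟩
  let f' : MvPolynomial (Fin r) ℚ →+* R := f.toRingHom.comp e.toRingHom
  have hf' : f'.IsIntegral :=
    RingHom.IsIntegral.trans _ _ (RingHom.isIntegral_of_surjective _ hesurj) hfi
  have hcomp : f'.comp (map (Int.castRingHom ℚ)) =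
      j.comp (aeval x : MvPolynomial (Fin r) ℤ →ₐ[ℤ] A).toRingHom := by
    refine MvPolynomial.ringHom_ext (fun n => by simp) fun k => ?_
    simp [f', e, ← hNx]
  refine ⟨r, x, ?_, fun a => ?_⟩
  · intro p q h
    have h' : f' (map (Int.castRingHom ℚ) p) = f' (map (Int.castRingHom ℚ) q) := by
      have hp := DFunLike.congr_fun hcomp p
      have hq := DFunLike.congr_fun hcomp q
      simp only [RingHom.comp_apply] at hp hq
      rw [hp, hq]
      exact congrArg j h
    exact map_injective _ Int.cast_injective (heinj (hf h'))
  · let := f'.toAlgebra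
    let := (f'.comp (map (Int.castRingHom ℚ))).toAlgebra
    let : Algebra (MvPolynomial (Fin r) ℤ) (MvPolynomial (Fin r) ℚ) := algebraMvPolynomial
    have : IsScalarTower (MvPolynomial (Fin r) ℤ) (MvPolynomial (Fin r) ℚ) R :=
      .of_algebraMap_eq fun _ => rfl
    have : IsLocalization ((nonZeroDivisors ℤ).map (C (σ := Fin r)))
      (MvPolynomial (Fin r) ℚ) := MvPolynomial.isLocalization _ _
    obtain ⟨⟨_, n, hn, rfl⟩, p, hp, hpe⟩ :=
      IsIntegral.exists_multiple_integral_of_isLocalization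
        ((nonZeroDivisors ℤ).map (C (σ := Fin r))) (j a) (hf' (j a))
    refine ⟨n, nonZeroDivisors.ne_zero hn, p, hp, hj ?_⟩
    rw [Polynomial.hom_eval₂, ← hcomp, map_zero, ← hpe]
    congr 1
    rw [Submonoid.smul_def, Algebra.smul_def, map_mul]
    congr 1
    simp [RingHom.algebraMap_toAlgebra]

/-- The Schwartz–Zippel bound for zeros in the whole affine space over a finite field. -/
theorem card_zeros_mul_card_le {F : Type*} [Field F] [Fintype F] [DecidableEq F] {s : ℕ}
    {p : MvPolynomial (Fin s) F} (hp : p ≠ 0) :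
    (Finset.univ.filter fun v : Fin s → F => eval v p = 0).card * Fintype.card F ≤
      p.totalDegree * Fintype.card F ^ s := by
  have h := schwartz_zippel_totalDegree hp (Finset.univ : Finset F)
  have hq : (0 : ℚ≥0) < Fintype.card F := by exact_mod_cast Fintype.card_pos
  rw [Fintype.piFinset_univ, Finset.card_univ, div_le_div_iff₀ (by positivity) hq] at h
  exact_mod_cast h

/-- In a finite field `F`, at most `2 √|F|` elements generate a proper subfield. -/
theorem card_filter_closure_singleton_ne_top {F : Type*} [Field F] [Fintype F]
    [DecidablePred fun a : F => Subfield.closure {a} ≠ ⊤] :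
    ((Finset.univ.filter fun a : F => Subfield.closure {a} ≠ ⊤).card : ℝ) ≤
      2 * Real.sqrt (Fintype.card F) := by
  classical
  obtain ⟨p, hchar⟩ := CharP.exists F
  obtain ⟨n, hp, hn⟩ := FiniteField.card F p
  have hp2 := hp.two_le
  let Z (d : ℕ) : Finset F := (Polynomial.X ^ p ^ d - Polynomial.X : Polynomial F).roots.toFinset
  have hZ (d : ℕ) (hd : d ≠ 0) : (Z d).card ≤ p ^ d := by
    refine (Multiset.toFinset_card_le _).trans ((Polynomial.card_roots' _).trans ?_)
    rw [FiniteField.X_pow_card_pow_sub_X_natDegree_eq F hd hp.one_lt]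
  have hsub : (Finset.univ.filter fun a : F => Subfield.closure {a} ≠ ⊤) ⊆
      (Finset.Icc 1 ((n : ℕ) / 2)).biUnion Z := by
    intro a ha
    rw [Finset.mem_filter] at ha
    let K := Subfield.closure {a}
    obtain ⟨d, -, hd⟩ := FiniteField.card K p
    have hK := Module.card_eq_pow_finrank (K := K) (V := F)
    rw [hn, hd, ← pow_mul] at hK
    have hdn := Nat.pow_right_injective hp2 hK
    have hr0 : Module.finrank K F ≠ 0 := Module.finrank_pos.ne'
    have hr1 : Module.finrank K F ≠ 1 := by
      intro h
      apply ha.2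
      rw [eq_top_iff]
      intro z _
      have hc : Fintype.card K = Fintype.card F := by
        rw [Module.card_eq_pow_finrank (K := K) (V := F), h, pow_one]
      have hb := (Fintype.bijective_iff_injective_and_card (Subtype.val : K → F)).2
        ⟨Subtype.val_injective, hc⟩
      obtain ⟨w, rfl⟩ := hb.2 z
      exact w.2
    have hr : 2 ≤ Module.finrank K F := by omega
    rw [Finset.mem_biUnion]
    refine ⟨d, Finset.mem_Icc.2 ⟨d.pos, ?_⟩, ?_⟩
    · rw [Nat.le_div_iff_mul_le two_pos, hdn]
      exact Nat.mul_le_mul_left _ hr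
    · rw [Multiset.mem_toFinset, Polynomial.mem_roots
        (FiniteField.X_pow_card_pow_sub_X_ne_zero F d.ne_zero hp.one_lt)]
      have hF := FiniteField.pow_card (⟨a, Subfield.subset_closure rfl⟩ : K)
      rw [hd] at hF
      simpa [sub_eq_zero] using congrArg Subtype.val hF
  have hcard : (Finset.univ.filter fun a : F => Subfield.closure {a} ≠ ⊤).card ≤
      2 * p ^ ((n : ℕ) / 2) := by
    refine (Finset.card_le_card hsub).trans (Finset.card_biUnion_le.trans ?_)
    calc ∑ d ∈ Finset.Icc 1 ((n : ℕ) / 2), (Z d).card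
        ≤ ∑ d ∈ Finset.range ((n : ℕ) / 2 + 1), p ^ d := by
          refine (Finset.sum_le_sum fun d hd => hZ d ?_).trans
            (Finset.sum_le_sum_of_subset fun d hd => ?_)
          · have := (Finset.mem_Icc.1 hd).1
            omega
          · have := (Finset.mem_Icc.1 hd).2
            exact Finset.mem_range.2 (by omega)
      _ ≤ 2 * p ^ ((n : ℕ) / 2) := by
          rw [Finset.sum_range_succ, two_mul]
          gcongr
          exact (Nat.geomSum_lt hp2 fun k hk => Finset.mem_range.1 hk).le
  have hsqrt : ((p ^ ((n : ℕ) / 2) : ℕ) : ℝ) ≤ Real.sqrt (Fintype.card F) := by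
    apply Real.le_sqrt_of_sq_le
    rw [hn]
    norm_cast
    rw [← pow_mul]
    exact Nat.pow_le_pow_right hp.pos (by omega)
  calc _ ≤ ((2 * p ^ ((n : ℕ) / 2) : ℕ) : ℝ) := by exact_mod_cast hcard
    _ ≤ _ := by push_cast at hsqrt ⊢; linarith

theorem ringHom_ext_of_adjoin_int_eq_top {A F : Type*} [CommRing A] [CommRing F] {t : Set A}
    (ht : Algebra.adjoin ℤ t = ⊤) {φ ψ : A →+* F} (h : ∀ a ∈ t, φ a = ψ a) : φ = ψ := by
  have := AlgHom.ext_of_adjoin_eq_top (φ₁ := φ.toIntAlgHom) (φ₂ := ψ.toIntAlgHom) ht h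
  ext a
  exact DFunLike.congr_fun this a

theorem finite_ringHom_of_finiteType_int (A F : Type*) [CommRing A] [Algebra.FiniteType ℤ A]
    [CommRing F] [Finite F] : Finite (A →+* F) := by
  obtain ⟨t, ht⟩ := Algebra.FiniteType.out (R := ℤ) (A := A)
  refine Finite.of_injective (fun (φ : A →+* F) (a : t) => φ a) fun φ ψ h => ?_
  exact ringHom_ext_of_adjoin_int_eq_top ht fun a ha => congrFun h ⟨a, ha⟩

theorem comp_aeval_int {A F σ : Type*} [CommRing A] [CommRing F] (x : σ → A) (φ : A →+* F) :
    φ.comp (aeval x : MvPolynomial σ ℤ →ₐ[ℤ] A).toRingHom =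
      eval₂Hom (Int.castRingHom F) (φ ∘ x) :=
  MvPolynomial.ringHom_ext (fun n => by simp) fun k => by simp

theorem card_filter_comp_eq_le {A F : Type*} [CommRing A] [Field F] [Fintype F] [DecidableEq F]
    [Fintype (A →+* F)] {s : ℕ} (x v : Fin s → _) {t : Finset A}
    (ht : Algebra.adjoin ℤ (t : Set A) = ⊤) (n : A → ℤ)
    (P : A → Polynomial (MvPolynomial (Fin s) ℤ)) (hP : ∀ a ∈ t, (P a).Monic)
    (hPa : ∀ a ∈ t, (P a).eval₂ (aeval x : MvPolynomial (Fin s) ℤ →ₐ[ℤ] A).toRingHom (n a * a) = 0)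
    (hn : ∀ a ∈ t, (n a : F) ≠ 0) :
    (Finset.univ.filter fun φ : A →+* F => φ ∘ x = v).card ≤ ∏ a ∈ t, (P a).natDegree := by
  classical
  let θ : MvPolynomial (Fin s) ℤ →+* F := eval₂Hom (Int.castRingHom F) v
  let Z (a : A) : Finset F := Finset.univ.filter fun y => ((P a).map θ).eval (n a * y) = 0
  have hZ (a : A) (ha : a ∈ t) : (Z a).card ≤ (P a).natDegree := by
    have h0 : (P a).map θ ≠ 0 := ((hP a ha).map θ).ne_zero
    calc (Z a).card ≤ ((P a).map θ).roots.toFinset.card := by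
          refine Finset.card_le_card_of_injOn (fun y => n a * y) (fun y hy => ?_)
            (mul_right_injective₀ (hn a ha)).injOn
          simpa [Z, h0] using hy
      _ ≤ ((P a).map θ).natDegree :=
          (Multiset.toFinset_card_le _).trans (Polynomial.card_roots' _)
      _ ≤ (P a).natDegree := Polynomial.natDegree_map_le
  calc _ ≤ (t.pi Z).card := by
        refine Finset.card_le_card_of_injOn (fun φ a _ => φ a) (fun φ hφ => ?_) ?_
        · have hφ' : φ ∘ x = v := by simpa using hφ
          refine Finset.mem_coe.2 (Finset.mem_pi.2 fun a ha => ?_)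
          have h := congrArg φ (hPa a ha)
          rw [Polynomial.hom_eval₂, comp_aeval_int, hφ', map_zero] at h
          simpa [Z, θ, Polynomial.eval_map] using h
        · intro φ _ ψ _ h
          exact ringHom_ext_of_adjoin_int_eq_top ht fun a ha => congrFun (congrFun h a) ha
    _ = ∏ a ∈ t, (Z a).card := Finset.card_pi _ _
    _ ≤ _ := Finset.prod_le_prod' hZ

theorem isAlgebraic_of_isIntegralElem_int_mul {A B : Type*} [CommRing A] [IsDomain A] [CharZero A]
    [CommRing B] [IsDomain B] [Algebra B A] [CharZero B] {a : A} {n : ℤ} (hn : n ≠ 0)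
    (h : (algebraMap B A).IsIntegralElem (n * a)) : IsAlgebraic B a := by
  have h' : IsIntegral B ((n : B) • a) := by
    rw [Algebra.smul_def, map_intCast]
    exact h
  exact h'.isAlgebraic.of_smul (mem_nonZeroDivisors_of_ne_zero (by exact_mod_cast hn))

universe u in
open Cardinal Algebra in
theorem card_eq_of_isTranscendenceBasis_int {A K : Type u} [CommRing A] [IsDomain A] [CharZero A]
    [Field K] [Algebra A K] [IsFractionRing A K] [Algebra ℚ K]
    {r s : ℕ} {b : Fin s → K} (hb : IsTranscendenceBasis ℚ b) {x : Fin r → A}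
    (hx : IsTranscendenceBasis ℤ x) : r = s := by
  have h₁ := hx.lift_cardinalMk_eq_trdeg
  have h₂ := hb.lift_cardinalMk_eq_trdeg
  have : FaithfulSMul A K := (faithfulSMul_iff_algebraMap_injective A K).2
    (IsFractionRing.injective A K)
  have : Algebra.IsAlgebraic A K := IsLocalization.isAlgebraic K (nonZeroDivisors A)
  have : Algebra.IsAlgebraic ℤ ℚ := IsLocalization.isAlgebraic ℚ (nonZeroDivisors ℤ)
  have h₃ := trdeg_add_eq ℤ A (A := K)
  have h₄ := lift_trdeg_add_eq ℤ ℚ K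
  rw [trdeg_eq_zero (R := A), add_zero] at h₃
  rw [trdeg_eq_zero (R := ℤ) (A := ℚ), lift_zero, zero_add, lift_id'] at h₄
  simp only [mk_fin, lift_natCast] at h₁ h₂
  rw [lift_uzero] at h₁ h₂
  have h : (r : Cardinal) = s := by rw [h₁, h₂, h₃, h₄]; simp
  exact_mod_cast h

/-- An algebraic dependence of `g` on `x` with coefficients polynomial in `g`. -/
theorem exists_ne_zero_eval₂_eq_zero {A : Type*} [CommRing A] {σ : Type*} (x : σ → A) {g : A}
    {P : Polynomial (MvPolynomial σ ℤ)} (hP : P ≠ 0)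
    (h : P.eval₂ (aeval x : MvPolynomial σ ℤ →ₐ[ℤ] A).toRingHom g = 0) :
    ∃ Q : MvPolynomial σ (Polynomial ℤ), Q ≠ 0 ∧
      eval₂Hom (Polynomial.aeval g : Polynomial ℤ →ₐ[ℤ] A).toRingHom x Q = 0 := by
  refine ⟨optionEquivRight ℤ σ ((optionEquivLeft ℤ σ).symm P), ?_, ?_⟩
  · rwa [Ne, EmbeddingLike.map_eq_zero_iff, EmbeddingLike.map_eq_zero_iff]
  obtain ⟨p, rfl⟩ := (optionEquivLeft ℤ σ).surjective P
  rw [AlgEquiv.symm_apply_apply]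
  refine Eq.trans ?_ h
  have key : ((eval₂Hom (Polynomial.aeval g : Polynomial ℤ →ₐ[ℤ] A).toRingHom x).comp
      (optionEquivRight ℤ σ : _ ≃ₐ[ℤ] _).toRingEquiv.toRingHom) =
      (Polynomial.eval₂RingHom (aeval x : MvPolynomial σ ℤ →ₐ[ℤ] A).toRingHom g).comp
      (optionEquivLeft ℤ σ : _ ≃ₐ[ℤ] _).toRingEquiv.toRingHom := by
    refine MvPolynomial.ringHom_ext (fun n => by simp) fun k => ?_
    cases k <;> simp
  exact DFunLike.congr_fun key p

theorem isTranscendenceBasis_int_of_isIntegralElem {A : Type*} [CommRing A] [IsDomain A]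
    [CharZero A] {r : ℕ} {x : Fin r → A} (hx : AlgebraicIndependent ℤ x)
    (h : ∀ a : A, ∃ n : ℤ, n ≠ 0 ∧
      (aeval x : MvPolynomial (Fin r) ℤ →ₐ[ℤ] A).toRingHom.IsIntegralElem (n * a)) :
    IsTranscendenceBasis ℤ x := by
  rw [hx.isTranscendenceBasis_iff_isAlgebraic]
  refine ⟨fun a => ?_⟩
  obtain ⟨n, hn, p, hp, hpa⟩ := h a
  have hcomp : (algebraMap (Algebra.adjoin ℤ (Set.range x)) A).comp
      hx.aevalEquiv.toRingEquiv.toRingHom =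
      (aeval x : MvPolynomial (Fin r) ℤ →ₐ[ℤ] A).toRingHom :=
    RingHom.ext fun q => hx.algebraMap_aevalEquiv q
  refine isAlgebraic_of_isIntegralElem_int_mul hn
    ⟨p.map hx.aevalEquiv.toRingEquiv.toRingHom, hp.map _, ?_⟩
  rw [Polynomial.eval₂_map, hcomp, hpa]

theorem map_eval₂Hom_aeval_int {A F σ : Type*} [CommRing A] [CommRing F] (x : σ → A) (g : A)
    (φ : A →+* F) (Q : MvPolynomial σ (Polynomial ℤ)) :
    φ (eval₂Hom (Polynomial.aeval g : Polynomial ℤ →ₐ[ℤ] A).toRingHom x Q) =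
      eval (φ ∘ x) (map (Polynomial.eval₂RingHom (Int.castRingHom F) (φ g)) Q) := by
  have : φ.comp (eval₂Hom (Polynomial.aeval g : Polynomial ℤ →ₐ[ℤ] A).toRingHom x) =
      (eval (φ ∘ x)).comp (map (Polynomial.eval₂RingHom (Int.castRingHom F) (φ g))) := by
    refine MvPolynomial.ringHom_ext (fun p => ?_) fun k => by simp
    simp only [RingHom.comp_apply, eval₂Hom_C, map_C, eval_C, AlgHom.toRingHom_eq_coe,
      RingHom.coe_coe, Polynomial.aeval_def, Polynomial.hom_eval₂, Polynomial.coe_eval₂RingHom]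
    congr 1
    exact RingHom.ext_int _ _
  exact DFunLike.congr_fun this Q

theorem map_int_ne_zero_of_coeff {F σ : Type*} [CommRing F] {p : MvPolynomial σ ℤ} {α : σ →₀ ℕ}
    (h : ((p.coeff α : ℤ) : F) ≠ 0) : map (Int.castRingHom F) p ≠ 0 := fun h0 =>
  h ((coeff_map _ _ _).symm.trans (congrArg (coeff α) h0))

theorem totalDegree_map_le {R S σ : Type*} [CommSemiring R] [CommSemiring S] (f : R →+* S)
    (p : MvPolynomial σ R) : (map f p).totalDegree ≤ p.totalDegree :=
  Finset.sup_mono (support_map_subset f p)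

/-- Counting points of `F ^ s` that annihilate `N`, or annihilate one of the nonzero
specializations of `Q` at an element of `S`. -/
theorem card_filter_zeros_mul_card_le {F : Type*} [Field F] [Fintype F] [DecidableEq F] {s : ℕ}
    {N : MvPolynomial (Fin s) ℤ} (hN : map (Int.castRingHom F) N ≠ 0)
    (Q : MvPolynomial (Fin s) (Polynomial ℤ)) (α : Fin s →₀ ℕ) (S : Finset F)
    {V : Finset (Fin s → F)}
    (hV : ∀ v ∈ V, eval v (map (Int.castRingHom F) N) = 0 ∨ ∃ a ∈ S,
      (Q.coeff α).eval₂ (Int.castRingHom F) a ≠ 0 ∧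
      eval v (map (Polynomial.eval₂RingHom (Int.castRingHom F) a) Q) = 0) :
    V.card * Fintype.card F ≤
      (N.totalDegree + S.card * Q.totalDegree) * Fintype.card F ^ s := by
  let Z (p : MvPolynomial (Fin s) F) := Finset.univ.filter fun v => eval v p = 0
  let Qa (a : F) := map (Polynomial.eval₂RingHom (Int.castRingHom F) a) Q
  let S' := S.filter fun a => (Q.coeff α).eval₂ (Int.castRingHom F) a ≠ 0
  have hsub : V ⊆ Z (map (Int.castRingHom F) N) ∪ S'.biUnion fun a => Z (Qa a) := by
    intro v hv
    rcases hV v hv with h | ⟨a, ha, hα, h⟩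
    · exact Finset.mem_union_left _ (by simpa [Z] using h)
    · refine Finset.mem_union_right _ (Finset.mem_biUnion.2 ⟨a, ?_, by simpa only [Z, Finset.mem_filter_univ] using h⟩)
      exact Finset.mem_filter.2 ⟨ha, hα⟩
  calc V.card * Fintype.card F
      ≤ ((Z (map (Int.castRingHom F) N)).card + ∑ a ∈ S', (Z (Qa a)).card) * Fintype.card F := by
        gcongr
        exact (Finset.card_le_card hsub).trans ((Finset.card_union_le _ _).trans
          (Nat.add_le_add_left Finset.card_biUnion_le _))
    _ = (Z (map (Int.castRingHom F) N)).card * Fintype.card F +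
          ∑ a ∈ S', (Z (Qa a)).card * Fintype.card F := by rw [add_mul, Finset.sum_mul]
    _ ≤ N.totalDegree * Fintype.card F ^ s + ∑ a ∈ S', Q.totalDegree * Fintype.card F ^ s := by
        refine add_le_add ((card_zeros_mul_card_le hN).trans
          (Nat.mul_le_mul_right _ (totalDegree_map_le _ _))) (Finset.sum_le_sum fun a ha => ?_)
        refine (card_zeros_mul_card_le fun h0 => ?_).trans
          (Nat.mul_le_mul_right _ (totalDegree_map_le _ _))
        exact (Finset.mem_filter.1 ha).2 ((coeff_map _ _ _).symm.trans (congrArg (coeff α) h0))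
    _ ≤ _ := by
        rw [Finset.sum_const, smul_eq_mul, add_mul, ← mul_assoc]
        gcongr
        exact Finset.filter_subset _ _

/-- Let `A` be an integral domain of characteristic `0` that is a finitely generated
`ℤ`-algebra, let `s` be the transcendence degree of `Frac(A)` over `ℚ`, and let
`g ∈ A` be transcendental over `ℚ`. Then there are `c > 0` and `m ≥ 1` such that for
every finite field `F` whose characteristic does not divide `m`, the set of ring
homomorphisms `φ : A → F` for which `φ(g)` generates (over the prime field) a proper
subfield of `F` is finite of size at most `c · |F|^s / √|F|`. -/
theorem stmt_11 {A : Type*} [CommRing A] [IsDomain A] [CharZero A]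
    [Algebra.FiniteType ℤ A] {s : ℕ}
    (hs : ∃ b : Fin s → FractionRing A, IsTranscendenceBasis ℚ b)
    (g : A) (hg : Transcendental ℚ (algebraMap A (FractionRing A) g)) :
    ∃ (c : ℝ) (m : ℕ), 0 < c ∧ 0 < m ∧
      ∀ (F : Type) [Field F] [Fintype F], ¬ (ringChar F ∣ m) →
        {φ : A →+* F | Subfield.closure {φ g} ≠ ⊤}.Finite ∧
        ({φ : A →+* F | Subfield.closure {φ g} ≠ ⊤}.ncard : ℝ) ≤
          c * (Fintype.card F : ℝ) ^ s / Real.sqrt (Fintype.card F) := by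
  classical
  obtain ⟨b, hb⟩ := hs
  obtain ⟨r, x, hx, hint⟩ := exists_algebraicIndependent_int_isIntegralElem (A := A)
  obtain rfl := card_eq_of_isTranscendenceBasis_int hb
    (isTranscendenceBasis_int_of_isIntegralElem hx hint)
  have hgℤ : Transcendental ℤ g := by
    rintro ⟨p, hp, hpg⟩
    refine hg ⟨p.map (Int.castRingHom ℚ),
      (Polynomial.map_ne_zero_iff Int.cast_injective).2 hp, ?_⟩
    have h := congrArg (algebraMap A (FractionRing A)) hpg
    rw [Polynomial.aeval_def, Polynomial.hom_eval₂, map_zero] at h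
    rw [Polynomial.aeval_def, Polynomial.eval₂_map, ← h]
    congr 1
    exact RingHom.ext_int _ _
  obtain ⟨t, ht⟩ := Algebra.FiniteType.out (R := ℤ) (A := A)
  let := (aeval x : MvPolynomial (Fin r) ℤ →ₐ[ℤ] A).toRingHom.toAlgebra
  have halg (a : A) : IsAlgebraic (MvPolynomial (Fin r) ℤ) a := by
    obtain ⟨n, hn, h⟩ := hint a
    exact isAlgebraic_of_isIntegralElem_int_mul hn h
  choose n hn P hP hPa using hint
  obtain ⟨R, hR, hRg⟩ := halg g
  obtain ⟨Q, hQ, hQg⟩ := exists_ne_zero_eval₂_eq_zero x hR hRg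
  obtain ⟨α, hα⟩ := ne_zero_iff.1 hQ
  have hβ : Polynomial.aeval g (Q.coeff α) ≠ 0 := fun h => hgℤ ⟨_, hα, h⟩
  obtain ⟨N, hN, hdvd⟩ := (halg (Polynomial.aeval g (Q.coeff α))).exists_nonzero_dvd
    (mem_nonZeroDivisors_of_ne_zero hβ)
  obtain ⟨ε, hε⟩ := ne_zero_iff.1 hN
  set D := ∏ a ∈ t, (P a).natDegree
  refine ⟨D * (N.totalDegree + 2 * Q.totalDegree) + 1, (N.coeff ε * ∏ a ∈ t, n a).natAbs,
    by positivity, Int.natAbs_pos.2 (mul_ne_zero hε (Finset.prod_ne_zero_iff.2 fun a _ => hn a)),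
    fun F _ _ hF => ?_⟩
  have := finite_ringHom_of_finiteType_int A F
  have := Fintype.ofFinite (A →+* F)
  refine ⟨Set.toFinite _, ?_⟩
  have hF' : ((N.coeff ε * ∏ a ∈ t, n a : ℤ) : F) ≠ 0 := by
    rwa [Ne, CharP.intCast_eq_zero_iff F (ringChar F), Int.natCast_dvd]
  rw [Int.cast_mul, mul_ne_zero_iff, Int.cast_prod, Finset.prod_ne_zero_iff] at hF'
  set T := Finset.univ.filter fun φ : A →+* F => Subfield.closure {φ g} ≠ ⊤ with hT
  have hncard : {φ : A →+* F | Subfield.closure {φ g} ≠ ⊤}.ncard = T.card := by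
    rw [← Set.ncard_coe_finset]
    simp [hT]
  rw [hncard]
  set S := Finset.univ.filter fun a : F => Subfield.closure {a} ≠ ⊤
  have hS : (S.card : ℝ) ≤ 2 * Real.sqrt (Fintype.card F) := card_filter_closure_singleton_ne_top
  have hTV : T.card ≤ D * (T.image fun φ : A →+* F => φ ∘ x).card :=
    Finset.card_le_mul_card_image _ _ fun v _ =>
      (Finset.card_le_card (Finset.filter_subset_filter _ (Finset.subset_univ _))).trans
        (card_filter_comp_eq_le x v ht n P (fun a _ => hP a) (fun a _ => hPa a) hF'.2)
  have hV := card_filter_zeros_mul_card_le (map_int_ne_zero_of_coeff hF'.1) Q α S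
    (V := T.image fun φ : A →+* F => φ ∘ x) (by
      simp only [Finset.mem_image]
      rintro _ ⟨φ, hφ, rfl⟩
      by_cases h : (Q.coeff α).eval₂ (Int.castRingHom F) (φ g) = 0
      · left
        have h1 : φ (Polynomial.aeval g (Q.coeff α)) = 0 := by
          rw [Polynomial.aeval_def, Polynomial.hom_eval₂, ← h]
          congr 1
          exact RingHom.ext_int _ _
        have h2 : φ (algebraMap (MvPolynomial (Fin r) ℤ) A N) = 0 :=
          zero_dvd_iff.1 (h1 ▸ map_dvd φ hdvd)
        rw [eval_map, ← h2]
        exact (DFunLike.congr_fun (comp_aeval_int x φ) N).symm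
      · refine Or.inr ⟨φ g, ?_, h, ?_⟩
        · simpa [S] using (Finset.mem_filter.1 hφ).2
        · rw [← map_eval₂Hom_aeval_int, hQg, map_zero])
  set q := Fintype.card F
  have hq : (1 : ℝ) ≤ q := by exact_mod_cast Fintype.card_pos
  have hq1 : 1 ≤ Real.sqrt q := Real.one_le_sqrt.2 hq
  have hsq : Real.sqrt q * Real.sqrt q = q := Real.mul_self_sqrt (by positivity)
  have hmain : (T.card : ℝ) * q ≤
      D * ((N.totalDegree + S.card * Q.totalDegree) * (q : ℝ) ^ r) := by
    have : T.card * q ≤ D * ((N.totalDegree + S.card * Q.totalDegree) * q ^ r) :=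
      (Nat.mul_le_mul_right q hTV).trans (by rw [mul_assoc]; exact Nat.mul_le_mul_left _ hV)
    exact_mod_cast this
  rw [le_div_iff₀ (by positivity)]
  refine le_of_mul_le_mul_right ?_ (zero_lt_one.trans_le hq1)
  calc (T.card : ℝ) * Real.sqrt q * Real.sqrt q = T.card * q := by rw [mul_assoc, hsq]
    _ ≤ D * ((N.totalDegree + S.card * Q.totalDegree) * (q : ℝ) ^ r) := hmain
    _ ≤ D * ((N.totalDegree * Real.sqrt q + 2 * Real.sqrt q * Q.totalDegree) * (q : ℝ) ^ r) := by
      gcongr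
      exact le_mul_of_one_le_right (by positivity) hq1
    _ = D * (N.totalDegree + 2 * Q.totalDegree) * (q : ℝ) ^ r * Real.sqrt q := by ring
    _ ≤ _ := by
      gcongr
      linarith
end

section
/- Let k₀ be a finite field, let A be an integral domain that is a finitely generated k₀-algebra, let s be the transcendence degree of the fraction field of A over k₀, and let g ∈ A be transcendental over k₀. Then there exists a real constant c > 0 such that for every finite field F equipped with a k₀-algebra structure (i.e., every finite field extension F of k₀) and every t ∈ F, the number of k₀-algebra homomorphisms φ : A → F with φ(g) = t is finite and at most c·|F|^{s−1}. -/
open Algebra Polynomial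

/-- An algebra of finite type has only finitely many homomorphisms into a finite algebra. -/
theorem finite_algHom_of_finiteType (k A F : Type*) [CommRing k] [CommRing A] [Algebra k A]
    [Algebra.FiniteType k A] [CommRing F] [Finite F] [Algebra k F] : Finite (A →ₐ[k] F) := by
  obtain ⟨S, hS⟩ := ‹Algebra.FiniteType k A›.out
  refine Finite.of_injective (fun (φ : A →ₐ[k] F) (a : S) => φ a) fun φ ψ h => ?_
  exact AlgHom.ext_of_adjoin_eq_top hS fun a ha => congrFun h ⟨a, ha⟩

/-- If `A` is of finite type and algebraic over the subalgebra generated by a family `y`, then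
away from the zero locus of some nonzero `h`, a homomorphism to a field is determined by its
values on `y` up to boundedly many choices. -/
theorem exists_ncard_algHom_le_of_isAlgebraic {k A ι : Type*} [Field k] [CommRing A] [IsDomain A]
    [Algebra k A] [Algebra.FiniteType k A] (y : ι → A)
    [Algebra.IsAlgebraic (adjoin k (Set.range y)) A] :
    ∃ h : A, h ≠ 0 ∧ ∃ c : ℕ, ∀ (F : Type) [Field F] [Finite F] [Algebra k F] (v : ι → F),
      {φ : A →ₐ[k] F | φ ∘ y = v ∧ φ h ≠ 0}.ncard ≤ c := by
  classical
  obtain ⟨S, hS⟩ := ‹Algebra.FiniteType k A›.out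
  choose P hP0 hP using fun a : A =>
    Algebra.IsAlgebraic.isAlgebraic (R := adjoin k (Set.range y)) a
  refine ⟨∏ a ∈ S, ((P a).leadingCoeff : A), Finset.prod_ne_zero_iff.mpr fun a _ => by
    simpa using hP0 a, ∏ a : S, (P a).natDegree, fun F _ _ _ v => ?_⟩
  have : Finite (A →ₐ[k] F) := finite_algHom_of_finiteType k A F
  obtain hE | ⟨φ₀, hφ₀, -⟩ := Set.eq_empty_or_nonempty
    {φ : A →ₐ[k] F | φ ∘ y = v ∧ φ (∏ a ∈ S, ((P a).leadingCoeff : A)) ≠ 0}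
  · rw [hE]
    simp
  set f : adjoin k (Set.range y) →ₐ[k] F := φ₀.comp (Subalgebra.val _) with hf
  have key : ∀ φ : A →ₐ[k] F, φ ∘ y = v → φ.comp (Subalgebra.val _) = f := by
    intro φ hφ
    refine AlgHom.adjoin_ext ?_
    rintro _ ⟨i, rfl⟩
    simpa [hf] using congrFun (hφ.trans hφ₀.symm) i
  let T : Finset (S → F) :=
    Fintype.piFinset fun a : S => ((P a).map f.toRingHom).roots.toFinset
  calc _ ≤ (T : Set (S → F)).ncard := by
        refine Set.ncard_le_ncard_of_injOn (fun φ a => φ a) ?_ ?_ T.finite_toSet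
        · rintro φ ⟨hφ, hne⟩
          simp only [T, Finset.mem_coe, Fintype.mem_piFinset, Multiset.mem_toFinset]
          rintro ⟨a, ha⟩
          rw [map_prod, Finset.prod_ne_zero_iff] at hne
          have hlc : f (P a).leadingCoeff ≠ 0 := by
            rw [← key φ hφ]
            exact hne a ha
          rw [mem_roots', IsRoot, eval_map]
          refine ⟨fun h0 => hlc ?_, ?_⟩
          · simpa using congrArg (fun q => q.coeff (P a).natDegree) h0
          · have := congrArg φ (hP a)
            rw [aeval_def, map_zero] at this
            rw [← this, ← key φ hφ]
            exact (hom_eval₂ (P a) _ (φ : A →+* F) a).symm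
        · intro φ _ ψ _ h
          exact AlgHom.ext_of_adjoin_eq_top hS fun a ha => congrFun h ⟨a, ha⟩
    _ ≤ _ := by
        rw [Set.ncard_coe_finset, Fintype.card_piFinset]
        refine Finset.prod_le_prod' fun a _ => ?_
        exact (Multiset.toFinset_card_le _).trans
          ((card_roots' _).trans natDegree_map_le)

/-- Killing a nonzero prime of a domain of finite transcendence degree drops the transcendence
degree. -/
theorem trdeg_quotient_lt {k A : Type*} [Field k] [CommRing A] [IsDomain A] [Algebra k A]
    (hfin : trdeg k A < Cardinal.aleph0) (p : Ideal A) [p.IsPrime] (hp : p ≠ ⊥) :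
    trdeg k (A ⧸ p) < trdeg k A := by
  have : FaithfulSMul k (A ⧸ p) := (faithfulSMul_iff_algebraMap_injective k _).mpr
    (algebraMap k (A ⧸ p)).injective
  obtain ⟨ι, z, hz⟩ := exists_isTranscendenceBasis' k (A ⧸ p)
  choose y hy using fun i => Ideal.Quotient.mk_surjective (z i)
  have hzy : (Ideal.Quotient.mkₐ k p) ∘ y = z := funext hy
  have hyi : AlgebraicIndependent k y :=
    AlgebraicIndependent.of_comp (Ideal.Quotient.mkₐ k p) (hzy ▸ hz.1)
  rw [← hz.cardinalMk_eq_trdeg]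
  by_contra! hle
  have hyb := hyi.isTranscendenceBasis_of_trdeg_le hfin hle
  have := hyb.isAlgebraic
  obtain ⟨a, hap, ha0⟩ := Submodule.exists_mem_ne_zero_of_ne_bot hp
  obtain ⟨⟨r, hr⟩, hr0, hdvd⟩ :=
    (Algebra.IsAlgebraic.isAlgebraic (R := adjoin k (Set.range y)) a).exists_nonzero_dvd
      (mem_nonZeroDivisors_of_ne_zero ha0)
  have hrp : r ∈ p := p.mem_of_dvd hdvd hap
  rw [Algebra.adjoin_range_eq_range_aeval] at hr
  obtain ⟨q, rfl⟩ := hr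
  have hq : q = 0 := by
    refine (injective_iff_map_eq_zero _).mp hz.1 q ?_
    have hcomp : MvPolynomial.aeval z = (Ideal.Quotient.mkₐ k p).comp (MvPolynomial.aeval y) := by
      ext i
      simp [hy]
    rw [hcomp]
    exact Ideal.Quotient.eq_zero_iff_mem.mpr hrp
  exact hr0 (Subtype.ext (by simp [hq]))

/-- A domain `A` of finite type over `k` and of transcendence degree `n`, with transcendence
basis `y`, has `O(#V + |F| ^ (n - 1))` points over `F` whose `y`-coordinates lie in `V`. -/
theorem exists_ncard_algHom_le.{u} {k : Type*} [Field k] {n : ℕ} {A ι : Type u} [CommRing A]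
    [IsDomain A] [Algebra k A] [Algebra.FiniteType k A] (hn : trdeg k A = n)
    {y : ι → A} (hy : IsTranscendenceBasis k y) :
    ∃ c : ℕ, ∀ (F : Type) [Field F] [Finite F] [Algebra k F] (V : Set (ι → F)),
      {φ : A →ₐ[k] F | φ ∘ y ∈ V}.ncard ≤ c * (V.ncard + Nat.card F ^ (n - 1)) := by
  classical
  induction n using Nat.strong_induction_on generalizing A ι with
  | _ n ih =>
  have := hy.isAlgebraic
  have hcard := hy.lift_cardinalMk_eq_trdeg
  have hιfin : Finite ι := by
    rw [← Cardinal.lt_aleph0_iff_finite, ← Cardinal.lift_lt_aleph0, hcard, hn]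
    simp
  obtain ⟨h, h0, c, hc⟩ := exists_ncard_algHom_le_of_isAlgebraic (k := k) y
  have : IsNoetherianRing A := Algebra.FiniteType.isNoetherianRing k A
  have hquot : ∀ p ∈ (Ideal.span {h}).minimalPrimes, ∃ c : ℕ,
      ∀ (F : Type) [Field F] [Finite F] [Algebra k F],
        Nat.card (A ⧸ p →ₐ[k] F) ≤ c * Nat.card F ^ (n - 1) := by
    intro p hp
    have : p.IsPrime := hp.1.1
    have hp0 : p ≠ ⊥ := by
      rintro rfl
      exact h0 (by simpa using hp.1.2)
    have hlt := trdeg_quotient_lt (k := k) (by simp [hn]) p hp0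
    rw [hn] at hlt
    obtain ⟨m, hm⟩ := Cardinal.lt_aleph0.mp (hlt.trans Cardinal.natCast_lt_aleph0)
    have hmn : m < n := by rw [hm] at hlt; exact_mod_cast hlt
    have : FaithfulSMul k (A ⧸ p) := (faithfulSMul_iff_algebraMap_injective k _).mpr
      (algebraMap k (A ⧸ p)).injective
    obtain ⟨κ, z, hz⟩ := exists_isTranscendenceBasis' k (A ⧸ p)
    have hκ := hz.cardinalMk_eq_trdeg.trans hm
    have hκfin : Finite κ := by
      rw [← Cardinal.lt_aleph0_iff_finite, hκ]; simp
    have hκcard : Nat.card κ = m := by simp [Nat.card, hκ]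
    obtain ⟨d, hd⟩ := ih m hmn hm hz
    refine ⟨d * 2, fun F _ _ _ => ?_⟩
    have hF := hd F Set.univ
    have hpos : 0 < Nat.card F := Nat.card_pos
    simp only [Set.mem_univ, Set.ofPred_true, Set.ncard_univ, Nat.card_fun, hκcard] at hF
    refine hF.trans ?_
    rw [mul_assoc, two_mul]
    gcongr
    all_goals omega
  choose! d hd using hquot
  have hfin := Ideal.finite_minimalPrimes_of_isNoetherianRing A (Ideal.span {h})
  refine ⟨c + ∑ p ∈ hfin.toFinset, d p, fun F _ _ _ V => ?_⟩
  have : Finite (A →ₐ[k] F) := finite_algHom_of_finiteType k A F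
  have hcover : {φ : A →ₐ[k] F | φ ∘ y ∈ V} ⊆
      (⋃ v ∈ V.toFinite.toFinset, {φ : A →ₐ[k] F | φ ∘ y = v ∧ φ h ≠ 0}) ∪
      ⋃ p ∈ hfin.toFinset,
        Set.range fun ψ : A ⧸ p →ₐ[k] F => ψ.comp (Ideal.Quotient.mkₐ k p) := by
    intro φ hφ
    by_cases hφh : φ h = 0
    · right
      have hprime : (RingHom.ker φ).IsPrime := RingHom.ker_isPrime _
      obtain ⟨p, hp, hle⟩ := Ideal.exists_minimalPrimes_le
        (I := Ideal.span {h}) (J := RingHom.ker φ)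
        (by simpa [Ideal.span_le] using hφh)
      simp only [Set.mem_iUnion, Set.Finite.mem_toFinset]
      exact ⟨p, hp, Ideal.Quotient.liftₐ p φ fun a ha => hle ha, Ideal.Quotient.liftₐ_comp ..⟩
    · left
      simpa using ⟨hφ, hφh⟩
  have hleft := (V.toFinite.toFinset.set_ncard_biUnion_le fun v =>
      {φ : A →ₐ[k] F | φ ∘ y = v ∧ φ h ≠ 0}).trans
    (Finset.sum_le_card_nsmul _ _ c fun v _ => hc F v)
  have hright := (hfin.toFinset.set_ncard_biUnion_le fun p =>
      Set.range fun ψ : A ⧸ p →ₐ[k] F => ψ.comp (Ideal.Quotient.mkₐ k p)).trans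
    (Finset.sum_le_sum (g := fun p => d p * Nat.card F ^ (n - 1)) fun p hp => by
      have : Finite (A ⧸ p →ₐ[k] F) := finite_algHom_of_finiteType k _ F
      rw [← Set.image_univ]
      refine (Set.ncard_image_le Set.finite_univ).trans ?_
      rw [Set.ncard_univ]
      exact hd p (hfin.mem_toFinset.mp hp) F)
  rw [← Set.ncard_eq_toFinset_card V V.toFinite, smul_eq_mul] at hleft
  rw [← Finset.sum_mul] at hright
  refine (Set.ncard_le_ncard hcover (Set.toFinite _)).trans ((Set.ncard_union_le _ _).trans ?_)
  nlinarith [Nat.zero_le (c * Nat.card F ^ (n - 1)),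
    Nat.zero_le ((∑ p ∈ hfin.toFinset, d p) * V.ncard)]

/-- The functions on a finite type with one prescribed value. -/
theorem ncard_setOf_apply_eq {ι F : Type*} [Finite ι] [Finite F] (i : ι) (t : F) :
    {v : ι → F | v i = t}.ncard ≤ Nat.card F ^ (Nat.card ι - 1) := by
  classical
  have := Fintype.ofFinite ι
  calc _ ≤ (Set.univ : Set ({j // j ≠ i} → F)).ncard := by
        refine Set.ncard_le_ncard_of_injOn (fun v j => v j) (fun _ _ => trivial) ?_
          Set.finite_univ
        intro v hv w hw hvw
        funext j
        by_cases hj : j = i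
        · rw [hj, hv, hw]
        · exact congrFun hvw ⟨j, hj⟩
    _ = _ := by
        rw [Set.ncard_univ, Nat.card_fun]
        simp [Fintype.card_subtype_compl]

/-- Let `k₀` be a finite field, `A` an integral domain that is a finitely generated
`k₀`-algebra, `s` the transcendence degree of `Frac(A)` over `k₀`, and `g ∈ A`
transcendental over `k₀`. Then there is `c > 0` such that for every finite field
extension `F` of `k₀` and every `t ∈ F`, the set of `k₀`-algebra homomorphisms
`φ : A → F` with `φ(g) = t` is finite of size at most `c · |F|^(s-1)`. -/
theorem stmt_12 {k₀ : Type*} [Field k₀] [Fintype k₀]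
    {A : Type*} [CommRing A] [IsDomain A] [Algebra k₀ A] [Algebra.FiniteType k₀ A]
    {K : Type*} [Field K] [Algebra A K] [IsFractionRing A K]
    [Algebra k₀ K] [IsScalarTower k₀ A K]
    {s : ℕ} (hs : ∃ b : Fin s → K, IsTranscendenceBasis k₀ b)
    (g : A) (hg : Transcendental k₀ g) :
    ∃ c : ℝ, 0 < c ∧
      ∀ (F : Type) [Field F] [Fintype F] [Algebra k₀ F],
        ∀ t : F, {φ : A →ₐ[k₀] F | φ g = t}.Finite ∧
          ({φ : A →ₐ[k₀] F | φ g = t}.ncard : ℝ) ≤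
            c * (Fintype.card F : ℝ) ^ (s - 1) := by
  obtain ⟨b, hb⟩ := hs
  have hKA : Algebra.IsAlgebraic A K := IsLocalization.isAlgebraic K (nonZeroDivisors A)
  have : FaithfulSMul A K := (faithfulSMul_iff_algebraMap_injective A K).mpr
    (IsFractionRing.injective A K)
  have hs : trdeg k₀ A = s := by
    have h1 := lift_trdeg_add_eq k₀ A K
    have h2 := hb.lift_cardinalMk_eq_trdeg
    rw [trdeg_eq_zero (R := A), Cardinal.lift_zero, add_zero] at h1
    simp only [Cardinal.mk_fin, Cardinal.lift_natCast, Cardinal.lift_uzero] at h2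
    rw [← h2] at h1
    simpa using h1
  obtain ⟨T, hgT, hT⟩ := exists_isTranscendenceBasis_superset (R := k₀) (s := {g})
    (algebraicIndependent_unique_type_iff.mpr hg)
  have hcard := hT.cardinalMk_eq_trdeg.trans hs
  have : Finite T := by rw [← Cardinal.lt_aleph0_iff_finite, hcard]; simp
  have hTcard : Nat.card T = s := by rw [Nat.card, hcard]; simp
  obtain ⟨c, hc⟩ := exists_ncard_algHom_le hs hT
  refine ⟨2 * c + 1, by positivity, fun F _ _ _ t => ?_⟩
  have : Finite (A →ₐ[k₀] F) := finite_algHom_of_finiteType k₀ A F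
  refine ⟨Set.toFinite _, ?_⟩
  have h1 := hc F {v | v ⟨g, hgT rfl⟩ = t}
  have h2 := ncard_setOf_apply_eq (⟨g, hgT rfl⟩ : T) t
  rw [hTcard] at h2
  rw [← Nat.card_eq_fintype_card]
  have h3 : {φ : A →ₐ[k₀] F | φ g = t}.ncard ≤ (2 * c + 1) * Nat.card F ^ (s - 1) := by
    refine h1.trans ?_
    nlinarith [Nat.mul_le_mul_left c h2]
  exact_mod_cast h3
end
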